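/- arXiv:1411.6985 — 4 statements merged into one kernel-verified Lean document; each statement's English description precedes it below -/
import Mathlib

section
/- Let k be a field, let R1 and R2 be nonzero commutative noetherian k-algebras, and let M1, N1 be semidualizing R1-modules and M2, N2 be semidualizing R2-modules. Write B ≈ C for R-modules B, C when B ∈ B_C(R) and C ∈ B_B(R). Then M1 ⊗_k M2 ≈ N1 ⊗_k N2 (over R1 ⊗_k R2) if and only if M1 ≈ N1 (over R1) and M2 ≈ N2 (over R2). -/
open TensorProduct CategoryTheory

section TensorModule

variable (k : Type) [CommRing k] (R1 R2 : Type) [CommRing R1] [CommRing R2]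
  [Algebra k R1] [Algebra k R2]
variable (M1 M2 : Type) [AddCommGroup M1] [Module k M1] [Module R1 M1] [IsScalarTower k R1 M1]
  [AddCommGroup M2] [Module k M2] [Module R2 M2] [IsScalarTower k R2 M2]

/-- The action of `R2` on `M1 ⊗[k] M2` through the right factor, as an algebra morphism
to endomorphisms. -/
noncomputable def rightSMul : R2 →ₐ[k] Module.End k (M1 ⊗[k] M2) :=
  ((Module.endTensorEndAlgHom (R := k) (S := k) (A := k) (M := M1) (N := M2)).comp
      (Algebra.TensorProduct.includeRight (R := k) (A := Module.End k M1))).comp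
    (Algebra.lsmul k k M2 (A := R2))

/-- The `R2`-module structure on `M1 ⊗[k] M2` via the right factor. -/
noncomputable def rightModule : Module R2 (M1 ⊗[k] M2) :=
  Module.compHom _ (rightSMul k R2 M1 M2).toRingHom

/-- The `R1 ⊗[k] R2`-module structure on `M1 ⊗[k] M2`, characterized by
`(r1 ⊗ r2) • (m1 ⊗ m2) = (r1 • m1) ⊗ (r2 • m2)`; see `tensorModule_smul_tmul`. -/
noncomputable instance (priority := 10) tensorModule :
    Module (R1 ⊗[k] R2) (M1 ⊗[k] M2) :=
  letI m2 : Module R2 (M1 ⊗[k] M2) := rightModule k R2 M1 M2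
  haveI t2 : IsScalarTower k R2 (M1 ⊗[k] M2) := by
    refine IsScalarTower.of_algebraMap_smul (fun r x => ?_)
    show (rightSMul k R2 M1 M2) (algebraMap k R2 r) x = r • x
    rw [AlgHom.commutes]
    simp [Module.algebraMap_end_apply]
  haveI sc : SMulCommClass R1 R2 (M1 ⊗[k] M2) := by
    constructor
    intro r1 r2 x
    show r1 • (rightSMul k R2 M1 M2 r2) x = (rightSMul k R2 M1 M2 r2) (r1 • x)
    induction x using TensorProduct.induction_on with
    | zero => simp
    | tmul m n =>
        have h1 : (rightSMul k R2 M1 M2 r2) (m ⊗ₜ[k] n) = m ⊗ₜ[k] (r2 • n) := rfl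
        have h2 : (rightSMul k R2 M1 M2 r2) ((r1 • m) ⊗ₜ[k] n) = (r1 • m) ⊗ₜ[k] (r2 • n) := rfl
        rw [h1, smul_tmul', smul_tmul', h2]
    | add x y hx hy =>
        calc r1 • (rightSMul k R2 M1 M2 r2) (x + y)
            = r1 • ((rightSMul k R2 M1 M2 r2) x + (rightSMul k R2 M1 M2 r2) y) := by
              rw [(rightSMul k R2 M1 M2 r2).map_add]
          _ = r1 • (rightSMul k R2 M1 M2 r2) x + r1 • (rightSMul k R2 M1 M2 r2) y :=
              smul_add _ _ _
          _ = (rightSMul k R2 M1 M2 r2) (r1 • x) + (rightSMul k R2 M1 M2 r2) (r1 • y) := by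
              rw [hx, hy]
          _ = (rightSMul k R2 M1 M2 r2) (r1 • x + r1 • y) :=
              ((rightSMul k R2 M1 M2 r2).map_add _ _).symm
          _ = (rightSMul k R2 M1 M2 r2) (r1 • (x + y)) := by rw [smul_add]
  TensorProduct.Algebra.module

/-- The defining property of the `R1 ⊗[k] R2`-module structure on `M1 ⊗[k] M2`. -/
lemma tensorModule_smul_tmul (r1 : R1) (r2 : R2) (m : M1) (n : M2) :
    (r1 ⊗ₜ[k] r2 : R1 ⊗[k] R2) • (m ⊗ₜ[k] n : M1 ⊗[k] M2) = (r1 • m) ⊗ₜ[k] (r2 • n) := rfl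

end TensorModule

section HomAlg

variable (R : Type) [CommRing R]

/-- The `i`-th Ext group `Ext_R^i(M, N)`. -/
noncomputable def extGroup (M N : Type) [AddCommGroup M] [Module R M]
    [AddCommGroup N] [Module R N] (i : ℕ) : Type :=
  (((Ext R (ModuleCat R) i).obj (Opposite.op (ModuleCat.of R M))).obj (ModuleCat.of R N) :
    ModuleCat R)

/-- The `i`-th Tor group `Tor_i^R(M, N)`. -/
noncomputable def torGroup (M N : Type) [AddCommGroup M] [Module R M]
    [AddCommGroup N] [Module R N] (i : ℕ) : Type :=
  (((Tor (ModuleCat R) i).obj (ModuleCat.of R M)).obj (ModuleCat.of R N) : ModuleCat R)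

/-- `C` is a semidualizing `R`-module: it is finitely generated, the homothety map
`R → Hom_R(C,C)`, `r ↦ (x ↦ r • x)`, is bijective, and `Ext_R^i(C,C) = 0` for all `i > 0`. -/
noncomputable def IsSemidualizing (C : Type) [AddCommGroup C] [Module R C] : Prop :=
  Module.Finite R C ∧
  Function.Bijective (LinearMap.lsmul R C) ∧
  ∀ i : ℕ, 0 < i → Subsingleton (extGroup R C C i)

end HomAlg

section BassAuslander

open TensorProduct

variable (R : Type) [CommRing R]

/-- `M` belongs to the Bass class `B_C(R)`: the evaluation map
`C ⊗_R Hom_R(C,M) → M`, `c ⊗ f ↦ f c`, is bijective, and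
`Ext_R^i(C,M) = 0 = Tor_i^R(C, Hom_R(C,M))` for all `i > 0`. -/
noncomputable def MemBassClass (C M : Type) [AddCommGroup C] [Module R C]
    [AddCommGroup M] [Module R M] : Prop :=
  Function.Bijective (TensorProduct.lift
    ((LinearMap.id : (C →ₗ[R] M) →ₗ[R] (C →ₗ[R] M)).flip) : C ⊗[R] (C →ₗ[R] M) → M) ∧
  (∀ i : ℕ, 0 < i → Subsingleton (extGroup R C M i)) ∧
  (∀ i : ℕ, 0 < i → Subsingleton (torGroup R C (C →ₗ[R] M) i))

end BassAuslander

section ExtVanishing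

open Abelian

variable (R : Type) [CommRing R]

/-- The vanishing of `Ext_R^i(A, Y)`, with `Ext` defined through the derived category. -/
def ExtVanishes (A Y : Type) [AddCommGroup A] [Module R A] [AddCommGroup Y] [Module R Y]
    (i : ℕ) : Prop :=
  Subsingleton (Abelian.Ext (ModuleCat.of R A) (ModuleCat.of R Y) i)

variable {R}
variable {K F A Y : Type} [AddCommGroup K] [Module R K] [AddCommGroup F] [Module R F]
  [AddCommGroup A] [Module R A] [AddCommGroup Y] [Module R Y]

lemma extVanishes_iff {i : ℕ} :
    ExtVanishes R A Y i ↔ ∀ x : Abelian.Ext (ModuleCat.of R A) (ModuleCat.of R Y) i, x = 0 :=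
  ⟨fun h x => h.elim x 0, fun h => ⟨fun x y => (h x).trans (h y).symm⟩⟩

lemma ExtVanishes.of_projective [Module.Projective R A] (i : ℕ) :
    ExtVanishes R A Y (i + 1) := by
  have : Projective (ModuleCat.of R A) := (IsProjective.iff_projective A).1 inferInstance
  exact extVanishes_iff.2 fun x => x.eq_zero_of_projective

lemma subsingleton_ext_of_iso {X X' Z Z' : ModuleCat R} (e : X ≅ X') (e' : Z ≅ Z') {i : ℕ}
    (h : Subsingleton (Abelian.Ext X Z i)) : Subsingleton (Abelian.Ext X' Z' i) := by
  suffices ∀ x : Abelian.Ext X' Z' i, x = 0 from ⟨fun x y => (this x).trans (this y).symm⟩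
  intro x
  have h1 : ((Ext.mk₀ e.hom).comp (x.comp (Ext.mk₀ e'.inv) (add_zero i)) (zero_add i)) = 0 :=
    h.elim _ _
  have h2 : (Ext.mk₀ e.inv).comp (((Ext.mk₀ e.hom).comp
      (x.comp (Ext.mk₀ e'.inv) (add_zero i)) (zero_add i)).comp
      (Ext.mk₀ e'.hom) (add_zero i)) (zero_add i) = x := by
    simp
  rw [← h2, h1, Ext.zero_comp, Ext.comp_zero]

lemma ExtVanishes.of_linearEquiv {A' Y' : Type} [AddCommGroup A'] [Module R A'] [AddCommGroup Y']
    [Module R Y'] (e : A ≃ₗ[R] A') (e' : Y ≃ₗ[R] Y') {i : ℕ}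
    (h : ExtVanishes R A Y i) : ExtVanishes R A' Y' i :=
  subsingleton_ext_of_iso e.toModuleIso e'.toModuleIso h

/-- The short complex attached to a short exact sequence of modules. -/
noncomputable abbrev moduleShortComplex (f : K →ₗ[R] F) (g : F →ₗ[R] A) (hfg : Function.Exact f g) :
    ShortComplex (ModuleCat R) :=
  ShortComplex.mk (ModuleCat.ofHom f) (ModuleCat.ofHom g) (by
    ext x
    exact hfg.apply_apply_eq_zero x)

lemma moduleShortComplex_shortExact {f : K →ₗ[R] F} {g : F →ₗ[R] A} (hf : Function.Injective f)
    (hfg : Function.Exact f g) (hg : Function.Surjective g) :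
    (moduleShortComplex f g hfg).ShortExact where
  exact := (ShortComplex.moduleCat_exact_iff _).2 fun x hx => (hfg x).1 hx
  mono_f := (ModuleCat.mono_iff_injective _).2 hf
  epi_g := (ModuleCat.epi_iff_surjective _).2 hg

variable {f : K →ₗ[R] F} {g : F →ₗ[R] A} (hf : Function.Injective f)
    (hfg : Function.Exact f g) (hg : Function.Surjective g)
include hf hfg hg

lemma ExtVanishes.succ_of_shortExact {i : ℕ} (hK : ExtVanishes R K Y i)
    (hF : ExtVanishes R F Y (i + 1)) : ExtVanishes R A Y (i + 1) := by
  rw [extVanishes_iff] at *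
  intro x
  obtain ⟨y, rfl⟩ := Ext.contravariant_sequence_exact₃
    (moduleShortComplex_shortExact hf hfg hg) (ModuleCat.of R Y) x (hF _) (add_comm 1 i)
  rw [show y = 0 from hK y, Ext.comp_zero]

lemma ExtVanishes.of_succ_of_shortExact {i : ℕ} (hF : ExtVanishes R F Y i)
    (hA : ExtVanishes R A Y (i + 1)) : ExtVanishes R K Y i := by
  rw [extVanishes_iff] at *
  intro x
  obtain ⟨y, rfl⟩ := Ext.contravariant_sequence_exact₁
    (moduleShortComplex_shortExact hf hfg hg) (ModuleCat.of R Y) x (add_comm 1 i) (hA _)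
  rw [show y = 0 from hF y, Ext.comp_zero]

lemma ExtVanishes.one_of_shortExact (h : Function.Surjective (f.lcomp R Y))
    (hF : ExtVanishes R F Y 1) : ExtVanishes R A Y 1 := by
  rw [extVanishes_iff] at *
  intro x
  have hS := moduleShortComplex_shortExact hf hfg hg
  obtain ⟨y, rfl⟩ := Ext.contravariant_sequence_exact₃ hS (ModuleCat.of R Y) x (hF _) (add_zero 1)
  obtain ⟨φ, rfl⟩ := Ext.addEquiv₀.symm.surjective y
  obtain ⟨ψ, hψ⟩ := h φ.hom
  have : φ = (moduleShortComplex f g hfg).f ≫ ModuleCat.ofHom ψ := by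
    ext x
    exact (LinearMap.congr_fun hψ x).symm
  rw [Ext.addEquiv₀_symm_apply, this, ← Ext.mk₀_comp_mk₀, ← Ext.comp_assoc_of_second_deg_zero,
    hS.extClass_comp, Ext.zero_comp]

lemma ExtVanishes.lcomp_surjective (hA : ExtVanishes R A Y 1) :
    Function.Surjective (f.lcomp R Y) := by
  rw [extVanishes_iff] at hA
  have hS := moduleShortComplex_shortExact hf hfg hg
  intro φ
  obtain ⟨y, hy⟩ := Ext.contravariant_sequence_exact₁ hS (ModuleCat.of R Y)
    (Ext.mk₀ (ModuleCat.ofHom φ)) (add_zero 1) (hA _)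
  obtain ⟨ψ, rfl⟩ := Ext.addEquiv₀.symm.surjective y
  refine ⟨ψ.hom, ?_⟩
  rw [Ext.addEquiv₀_symm_apply, Ext.mk₀_comp_mk₀] at hy
  have := (Ext.mk₀_bijective _ _).1 hy
  exact congrArg ModuleCat.Hom.hom this

end ExtVanishing

section Comparison

variable {R : Type} [CommRing R]

lemma CategoryTheory.ProjectiveResolution.extVanishes_succ_iff {A Y : Type} [AddCommGroup A]
    [Module R A] [AddCommGroup Y] [Module R Y] (P : ProjectiveResolution (ModuleCat.of R A))
    (i : ℕ) :
    ExtVanishes R A Y (i + 1) ↔ ∀ φ : P.complex.X (i + 1) ⟶ ModuleCat.of R Y,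
      P.complex.d (i + 2) (i + 1) ≫ φ = 0 → ∃ ψ, P.complex.d (i + 1) i ≫ ψ = φ := by
  rw [extVanishes_iff]
  constructor
  · intro h φ hφ
    exact (P.extMk_eq_zero_iff φ (i + 2) rfl hφ i rfl).1 (h _)
  · intro h x
    obtain ⟨φ, hφ, rfl⟩ := P.extMk_surjective x (i + 2) rfl
    exact (P.extMk_eq_zero_iff φ (i + 2) rfl hφ i rfl).2 (h φ hφ)

lemma subsingleton_extGroup_succ_iff (A Y : Type) [AddCommGroup A] [Module R A]
    [AddCommGroup Y] [Module R Y] (i : ℕ) :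
    Subsingleton (extGroup R A Y (i + 1)) ↔ ExtVanishes R A Y (i + 1) := by
  let P := projectiveResolution (ModuleCat.of R A)
  rw [P.extVanishes_succ_iff, extGroup, ← ModuleCat.isZero_iff_subsingleton,
    (P.isoExt (i + 1) (ModuleCat.of R Y)).isZero_iff,
    ← HomologicalComplex.exactAt_iff_isZero_homology,
    HomologicalComplex.exactAt_iff' _ i (i + 1) (i + 2) (by simp) (by simp),
    ShortComplex.moduleCat_exact_iff]
  rfl

lemma function_exact_iff_dual {B C D : Type} [AddCommGroup B] [Module R B] [AddCommGroup C]
    [Module R C] [AddCommGroup D] [Module R D] (f : B →ₗ[R] C) (g : C →ₗ[R] D) :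
    (∀ y, g y = 0 → ∃ x, f x = y) ↔
      ∀ c : CharacterModule C, CharacterModule.dual f c = 0 →
        ∃ c' : CharacterModule D, CharacterModule.dual g c' = c := by
  constructor
  · intro h c hc
    let π : C →+ LinearMap.range g := g.rangeRestrict.toAddMonoidHom
    have hπ : Function.Surjective π := g.surjective_rangeRestrict
    have hker : π.ker ≤ AddMonoidHom.ker (G := C) c := by
      intro y hy
      obtain ⟨x, rfl⟩ := h y (congrArg Subtype.val hy)
      exact DFunLike.congr_fun hc x
    let c₀ : CharacterModule (LinearMap.range g) := π.liftOfSurjective hπ ⟨c, hker⟩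
    obtain ⟨c', hc'⟩ := CharacterModule.dual_surjective_of_injective
      (LinearMap.range g).subtype Subtype.val_injective c₀
    refine ⟨c', DFunLike.ext _ _ fun y => ?_⟩
    have h1 : c' (g y) = c₀ (π y) := DFunLike.congr_fun hc' (π y)
    exact h1.trans (AddMonoidHom.liftOfRightInverse_comp_apply _ _ _ ⟨c, hker⟩ y)
  · intro h y hy
    by_contra hne
    let q : C →ₗ[R] C ⧸ LinearMap.range f := (LinearMap.range f).mkQ
    have hq : q y ≠ 0 := fun h0 => hne ((Submodule.Quotient.mk_eq_zero _).1 h0)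
    obtain ⟨c, hc⟩ := CharacterModule.exists_character_apply_ne_zero_of_ne_zero hq
    obtain ⟨c', hc'⟩ := h (CharacterModule.dual q c) (DFunLike.ext _ _ fun x => by
      have : q (f x) = 0 := (Submodule.Quotient.mk_eq_zero _).2 ⟨x, rfl⟩
      change c (q (f x)) = 0
      rw [this, map_zero])
    apply hc
    have h1 : c' (g y) = c (q y) := DFunLike.congr_fun hc' y
    rw [← h1, hy, map_zero]

/-- Hom-tensor adjunction for character modules. -/
noncomputable def homCharacterEquiv (N B : Type) [AddCommGroup N] [Module R N] [AddCommGroup B]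
    [Module R B] : (B →ₗ[R] CharacterModule N) ≃ₗ[R] CharacterModule (N ⊗[R] B) :=
  CharacterModule.homEquiv.trans (CharacterModule.congr (TensorProduct.comm R B N))

lemma dual_lTensor_homCharacterEquiv {N B C : Type} [AddCommGroup N] [Module R N] [AddCommGroup B]
    [Module R B] [AddCommGroup C] [Module R C] (f : B →ₗ[R] C) (φ : C →ₗ[R] CharacterModule N) :
    CharacterModule.dual (f.lTensor N) (homCharacterEquiv N C φ) =
      homCharacterEquiv N B (φ ∘ₗ f) := by
  refine DFunLike.ext _ _ fun x => ?_
  induction x using TensorProduct.induction_on with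
  | zero => exact (map_zero _).trans (map_zero _).symm
  | tmul n b => rfl
  | add x y hx hy => exact (map_add _ x y).trans ((congrArg₂ _ hx hy).trans (map_add _ x y).symm)

lemma lTensor_exact_iff_hom_character_exact (N : Type) {B C D : Type} [AddCommGroup N] [Module R N]
    [AddCommGroup B] [Module R B] [AddCommGroup C] [Module R C] [AddCommGroup D] [Module R D]
    (f : B →ₗ[R] C) (g : C →ₗ[R] D) :
    (∀ y, g.lTensor N y = 0 → ∃ x, f.lTensor N x = y) ↔
      ∀ φ : C →ₗ[R] CharacterModule N, φ ∘ₗ f = 0 → ∃ ψ, ψ ∘ₗ g = φ := by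
  rw [function_exact_iff_dual, (homCharacterEquiv N C).surjective.forall]
  refine forall_congr' fun φ => ?_
  rw [dual_lTensor_homCharacterEquiv, LinearEquiv.map_eq_zero_iff,
    (homCharacterEquiv N D).surjective.exists]
  simp_rw [dual_lTensor_homCharacterEquiv, EmbeddingLike.apply_eq_iff_eq]

lemma subsingleton_torGroup_succ_iff (N H : Type) [AddCommGroup N] [Module R N]
    [AddCommGroup H] [Module R H] (i : ℕ) :
    Subsingleton (torGroup R N H (i + 1)) ↔ ExtVanishes R H (CharacterModule N) (i + 1) := by
  let P := projectiveResolution (ModuleCat.of R H)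
  rw [P.extVanishes_succ_iff, torGroup, ← ModuleCat.isZero_iff_subsingleton, Tor_obj,
    (P.isoLeftDerivedObj _ (i + 1)).isZero_iff, HomologicalComplex.homologyFunctor_obj,
    ← HomologicalComplex.exactAt_iff_isZero_homology,
    HomologicalComplex.exactAt_iff' _ (i + 2) (i + 1) i (by simp) (by simp),
    ShortComplex.moduleCat_exact_iff]
  refine (lTensor_exact_iff_hom_character_exact N (P.complex.d (i + 2) (i + 1)).hom
    (P.complex.d (i + 1) i).hom).trans ⟨fun h φ hφ => ?_, fun h φ hφ => ?_⟩
  · obtain ⟨ψ, hψ⟩ := h φ.hom (congrArg ModuleCat.Hom.hom hφ)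
    exact ⟨ModuleCat.ofHom ψ, ModuleCat.hom_ext hψ⟩
  · obtain ⟨ψ, hψ⟩ := h (ModuleCat.ofHom φ) (ModuleCat.hom_ext hφ)
    exact ⟨ψ.hom, congrArg ModuleCat.Hom.hom hψ⟩

end Comparison

section TensorMaps

variable {k : Type} [Field k] {R1 R2 : Type} [CommRing R1] [CommRing R2]
  [Algebra k R1] [Algebra k R2]

/-- An additive map compatible with the action of pure tensors is linear over the tensor product
of the algebras. -/
def AddMonoidHom.toTensorLinearMap {X Y : Type} [AddCommMonoid X] [AddCommMonoid Y]
    [Module (R1 ⊗[k] R2) X] [Module (R1 ⊗[k] R2) Y] (φ : X →+ Y)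
    (h : ∀ (r1 : R1) (r2 : R2) (x : X),
      φ ((r1 ⊗ₜ[k] r2 : R1 ⊗[k] R2) • x) = (r1 ⊗ₜ[k] r2 : R1 ⊗[k] R2) • φ x) :
    X →ₗ[R1 ⊗[k] R2] Y where
  toFun := φ
  map_add' := map_add φ
  map_smul' r x := by
    induction r using TensorProduct.induction_on with
    | zero => simp
    | tmul r1 r2 => exact h r1 r2 x
    | add r s hr hs => simp_all [add_smul]

variable {A1 B1 C1 A2 B2 C2 : Type}
  [AddCommGroup A1] [Module k A1] [Module R1 A1] [IsScalarTower k R1 A1]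
  [AddCommGroup B1] [Module k B1] [Module R1 B1] [IsScalarTower k R1 B1]
  [AddCommGroup C1] [Module k C1] [Module R1 C1] [IsScalarTower k R1 C1]
  [AddCommGroup A2] [Module k A2] [Module R2 A2] [IsScalarTower k R2 A2]
  [AddCommGroup B2] [Module k B2] [Module R2 B2] [IsScalarTower k R2 B2]
  [AddCommGroup C2] [Module k C2] [Module R2 C2] [IsScalarTower k R2 C2]

lemma tensorModule_smul_eq_map (r1 : R1) (r2 : R2) (x : A1 ⊗[k] A2) :
    (r1 ⊗ₜ[k] r2 : R1 ⊗[k] R2) • x =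
      TensorProduct.map (Algebra.lsmul k k A1 r1) (Algebra.lsmul k k A2 r2) x := by
  induction x using TensorProduct.induction_on with
  | zero => simp
  | tmul a b => simp [tensorModule_smul_tmul]
  | add x y hx hy => simp [hx, hy]

variable (k) in
/-- The tensor product of an `R1`-linear and an `R2`-linear map, as an `R1 ⊗[k] R2`-linear map. -/
noncomputable def tmap (f : A1 →ₗ[R1] B1) (g : A2 →ₗ[R2] B2) :
    A1 ⊗[k] A2 →ₗ[R1 ⊗[k] R2] B1 ⊗[k] B2 :=
  (TensorProduct.map (f.restrictScalars k) (g.restrictScalars k)).toAddMonoidHom.toTensorLinearMap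
    (by
      intro r1 r2 x
      induction x using TensorProduct.induction_on with
      | zero => simp
      | tmul a b => simp [tensorModule_smul_tmul]
      | add x y hx hy => simp_all)

@[simp]
lemma tmap_tmul (f : A1 →ₗ[R1] B1) (g : A2 →ₗ[R2] B2) (a : A1) (b : A2) :
    tmap k f g (a ⊗ₜ b) = f a ⊗ₜ g b := rfl

lemma tmap_injective {f : A1 →ₗ[R1] B1} {g : A2 →ₗ[R2] B2} (hf : Function.Injective f)
    (hg : Function.Injective g) : Function.Injective (tmap k f g) :=
  TensorProduct.map_injective_of_flat_flat (f.restrictScalars k) (g.restrictScalars k) hf hg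

lemma tmap_surjective {f : A1 →ₗ[R1] B1} {g : A2 →ₗ[R2] B2} (hf : Function.Surjective f)
    (hg : Function.Surjective g) : Function.Surjective (tmap k f g) :=
  TensorProduct.map_surjective (g := f.restrictScalars k) (g' := g.restrictScalars k) hf hg

lemma tmap_exact_left {f : A1 →ₗ[R1] B1} {g : B1 →ₗ[R1] C1} (hfg : Function.Exact f g)
    (hg : Function.Surjective g) :
    Function.Exact (tmap k f (LinearMap.id : A2 →ₗ[R2] A2))
      (tmap k g (LinearMap.id : A2 →ₗ[R2] A2)) :=
  rTensor_exact A2 (f := f.restrictScalars k) (g := g.restrictScalars k) hfg hg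

lemma tmap_exact_right {f : A2 →ₗ[R2] B2} {g : B2 →ₗ[R2] C2} (hfg : Function.Exact f g)
    (hg : Function.Surjective g) :
    Function.Exact (tmap k (LinearMap.id : A1 →ₗ[R1] A1) f)
      (tmap k (LinearMap.id : A1 →ₗ[R1] A1) g) :=
  lTensor_exact A1 (f := f.restrictScalars k) (g := g.restrictScalars k) hfg hg

lemma tensorModule_finsupp_projective (ι κ : Type) :
    Module.Projective (R1 ⊗[k] R2) ((ι →₀ R1) ⊗[k] (κ →₀ R2)) := by
  classical
  let e := finsuppTensorFinsupp k k R1 R2 ι κ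
  let φ : (ι →₀ R1) ⊗[k] (κ →₀ R2) →ₗ[R1 ⊗[k] R2] (ι × κ →₀ R1 ⊗[k] R2) :=
    AddMonoidHom.toTensorLinearMap (e : _ →+ _) (by
    intro r1 r2 x
    induction x using TensorProduct.induction_on with
    | zero => simp
    | add x y hx hy => simp_all
    | tmul a b =>
      ext ⟨i, j⟩
      simp [e, tensorModule_smul_tmul])
  exact Module.Projective.of_equiv (LinearEquiv.ofBijective φ e.bijective).symm

end TensorMaps

section Kunneth

lemma Module.Finite.exists_shortExact (k R A : Type) [Field k] [CommRing R] [Algebra k R]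
    [IsNoetherianRing R] [AddCommGroup A] [Module R A] [Module.Finite R A] :
    ∃ (m : ℕ) (K : Type) (_ : AddCommGroup K) (_ : Module k K) (_ : Module R K)
      (_ : IsScalarTower k R K) (_ : Module.Finite R K) (f : K →ₗ[R] (Fin m →₀ R))
      (g : (Fin m →₀ R) →ₗ[R] A),
      Function.Injective f ∧ Function.Exact f g ∧ Function.Surjective g := by
  obtain ⟨m, g, hg⟩ := Module.Finite.exists_fin' R A
  let g' := g ∘ₗ (Finsupp.linearEquivFunOnFinite R R (Fin m)).toLinearMap
  exact ⟨m, LinearMap.ker g', inferInstance, inferInstance, inferInstance, inferInstance,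
    inferInstance, (LinearMap.ker g').subtype, g', (LinearMap.ker g').injective_subtype,
    LinearMap.exact_subtype_ker_map g',
    hg.comp (Finsupp.linearEquivFunOnFinite R R (Fin m)).surjective⟩

variable (k : Type) [Field k] (R1 R2 : Type) [CommRing R1] [CommRing R2]
  [Algebra k R1] [Algebra k R2]

/-- Compatibility of `Hom(-, Y)` over `R1 ⊗[k] R2` with `Hom(-, Y1)` and `Hom(-, Y2)`: extending
maps along `f : K → F` is possible for all maps to `Y1` (or `Y2`) if and only if it is possible
for all maps to `Y` along the tensor product of `f` with a finitely generated module. -/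
structure KunnethCompatible (Y1 Y2 Y : Type) [AddCommGroup Y1] [Module R1 Y1] [AddCommGroup Y2]
    [Module R2 Y2] [AddCommGroup Y] [Module (R1 ⊗[k] R2) Y] : Prop where
  left {K F A : Type} [AddCommGroup K] [Module k K] [Module R1 K] [IsScalarTower k R1 K]
    [AddCommGroup F] [Module k F] [Module R1 F] [IsScalarTower k R1 F]
    [AddCommGroup A] [Module k A] [Module R2 A] [IsScalarTower k R2 A]
    [Module.Finite R1 K] [Module.Finite R1 F] [Module.Finite R2 A]
    (f : K →ₗ[R1] F) : Function.Surjective (f.lcomp R1 Y1) →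
      Function.Surjective ((tmap k f (LinearMap.id : A →ₗ[R2] A)).lcomp (R1 ⊗[k] R2) Y)
  of_left {K F A : Type} [AddCommGroup K] [Module k K] [Module R1 K] [IsScalarTower k R1 K]
    [AddCommGroup F] [Module k F] [Module R1 F] [IsScalarTower k R1 F]
    [AddCommGroup A] [Module k A] [Module R2 A] [IsScalarTower k R2 A]
    [Module.Finite R1 K] [Module.Finite R1 F] [Module.Finite R2 A] [Nontrivial (A →ₗ[R2] Y2)]
    (f : K →ₗ[R1] F) :
      Function.Surjective ((tmap k f (LinearMap.id : A →ₗ[R2] A)).lcomp (R1 ⊗[k] R2) Y) →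
      Function.Surjective (f.lcomp R1 Y1)
  right {K F A : Type} [AddCommGroup K] [Module k K] [Module R2 K] [IsScalarTower k R2 K]
    [AddCommGroup F] [Module k F] [Module R2 F] [IsScalarTower k R2 F]
    [AddCommGroup A] [Module k A] [Module R1 A] [IsScalarTower k R1 A]
    [Module.Finite R2 K] [Module.Finite R2 F] [Module.Finite R1 A]
    (f : K →ₗ[R2] F) : Function.Surjective (f.lcomp R2 Y2) →
      Function.Surjective ((tmap k (LinearMap.id : A →ₗ[R1] A) f).lcomp (R1 ⊗[k] R2) Y)
  of_right {K F A : Type} [AddCommGroup K] [Module k K] [Module R2 K] [IsScalarTower k R2 K]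
    [AddCommGroup F] [Module k F] [Module R2 F] [IsScalarTower k R2 F]
    [AddCommGroup A] [Module k A] [Module R1 A] [IsScalarTower k R1 A]
    [Module.Finite R2 K] [Module.Finite R2 F] [Module.Finite R1 A] [Nontrivial (A →ₗ[R1] Y1)]
    (f : K →ₗ[R2] F) :
      Function.Surjective ((tmap k (LinearMap.id : A →ₗ[R1] A) f).lcomp (R1 ⊗[k] R2) Y) →
      Function.Surjective (f.lcomp R2 Y2)

namespace KunnethCompatible

variable {k R1 R2}
variable {Y1 Y2 Y : Type} [AddCommGroup Y1] [Module R1 Y1] [AddCommGroup Y2]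
  [Module R2 Y2] [AddCommGroup Y] [Module (R1 ⊗[k] R2) Y]
  (H : KunnethCompatible k R1 R2 Y1 Y2 Y)

include H

lemma extVanishes_of_left [IsNoetherianRing R1]
    (A2 : Type) [AddCommGroup A2] [Module k A2] [Module R2 A2] [IsScalarTower k R2 A2]
    [Module.Finite R2 A2] (n : ℕ)
    (hA2 : ∀ m : ℕ, ∀ j ≤ n, ExtVanishes (R1 ⊗[k] R2) ((Fin m →₀ R1) ⊗[k] A2) Y (j + 1))
    (A1 : Type) [AddCommGroup A1] [Module k A1] [Module R1 A1] [IsScalarTower k R1 A1]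
    [Module.Finite R1 A1] (hA1 : ∀ j ≤ n, ExtVanishes R1 A1 Y1 (j + 1)) :
    ExtVanishes (R1 ⊗[k] R2) (A1 ⊗[k] A2) Y (n + 1) := by
  induction n generalizing A1 with
  | zero =>
    obtain ⟨m, K, _, _, _, _, _, f, g, hf, hfg, hg⟩ := Module.Finite.exists_shortExact k R1 A1
    exact .one_of_shortExact
      (tmap_injective hf Function.injective_id)
      (tmap_exact_left hfg hg) (tmap_surjective hg Function.surjective_id)
      (H.left f (ExtVanishes.lcomp_surjective hf hfg hg (hA1 0 le_rfl)))
      (hA2 m 0 le_rfl)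
  | succ n ih =>
    obtain ⟨m, K, _, _, _, _, _, f, g, hf, hfg, hg⟩ := Module.Finite.exists_shortExact k R1 A1
    exact .succ_of_shortExact
      (tmap_injective hf Function.injective_id)
      (tmap_exact_left hfg hg) (tmap_surjective hg Function.surjective_id)
      (ih (fun m j hj => hA2 m j (hj.trans n.le_succ)) K fun j hj =>
        .of_succ_of_shortExact hf hfg hg (.of_projective j)
          (hA1 (j + 1) (Nat.succ_le_succ hj)))
      (hA2 m (n + 1) le_rfl)

lemma extVanishes_of_right [IsNoetherianRing R2]
    (A1 : Type) [AddCommGroup A1] [Module k A1] [Module R1 A1] [IsScalarTower k R1 A1]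
    [Module.Finite R1 A1] (n : ℕ)
    (hA1 : ∀ m : ℕ, ∀ j ≤ n, ExtVanishes (R1 ⊗[k] R2) (A1 ⊗[k] (Fin m →₀ R2)) Y (j + 1))
    (A2 : Type) [AddCommGroup A2] [Module k A2] [Module R2 A2] [IsScalarTower k R2 A2]
    [Module.Finite R2 A2] (hA2 : ∀ j ≤ n, ExtVanishes R2 A2 Y2 (j + 1)) :
    ExtVanishes (R1 ⊗[k] R2) (A1 ⊗[k] A2) Y (n + 1) := by
  induction n generalizing A2 with
  | zero =>
    obtain ⟨m, K, _, _, _, _, _, f, g, hf, hfg, hg⟩ := Module.Finite.exists_shortExact k R2 A2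
    exact .one_of_shortExact
      (tmap_injective Function.injective_id hf)
      (tmap_exact_right hfg hg) (tmap_surjective Function.surjective_id hg)
      (H.right f (ExtVanishes.lcomp_surjective hf hfg hg (hA2 0 le_rfl)))
      (hA1 m 0 le_rfl)
  | succ n ih =>
    obtain ⟨m, K, _, _, _, _, _, f, g, hf, hfg, hg⟩ := Module.Finite.exists_shortExact k R2 A2
    exact .succ_of_shortExact
      (tmap_injective Function.injective_id hf)
      (tmap_exact_right hfg hg) (tmap_surjective Function.surjective_id hg)
      (ih (fun m j hj => hA1 m j (hj.trans n.le_succ)) K fun j hj =>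
        .of_succ_of_shortExact hf hfg hg (.of_projective j)
          (hA2 (j + 1) (Nat.succ_le_succ hj)))
      (hA1 m (n + 1) le_rfl)

lemma left_extVanishes [IsNoetherianRing R1]
    (A2 : Type) [AddCommGroup A2] [Module k A2] [Module R2 A2] [IsScalarTower k R2 A2]
    [Module.Finite R2 A2] [Nontrivial (A2 →ₗ[R2] Y2)] (n : ℕ)
    (hA2 : ∀ m : ℕ, ∀ j < n, ExtVanishes (R1 ⊗[k] R2) ((Fin m →₀ R1) ⊗[k] A2) Y (j + 1))
    (A1 : Type) [AddCommGroup A1] [Module k A1] [Module R1 A1] [IsScalarTower k R1 A1]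
    [Module.Finite R1 A1] (hA : ExtVanishes (R1 ⊗[k] R2) (A1 ⊗[k] A2) Y (n + 1)) :
    ExtVanishes R1 A1 Y1 (n + 1) := by
  induction n generalizing A1 with
  | zero =>
    obtain ⟨m, K, _, _, _, _, _, f, g, hf, hfg, hg⟩ := Module.Finite.exists_shortExact k R1 A1
    exact .one_of_shortExact hf hfg hg
      (H.of_left (A := A2) f (ExtVanishes.lcomp_surjective
        (tmap_injective hf Function.injective_id)
        (tmap_exact_left hfg hg) (tmap_surjective hg Function.surjective_id) hA))
      (.of_projective 0)
  | succ n ih =>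
    obtain ⟨m, K, _, _, _, _, _, f, g, hf, hfg, hg⟩ := Module.Finite.exists_shortExact k R1 A1
    exact .succ_of_shortExact hf hfg hg
      (ih (fun m j hj => hA2 m j (hj.trans n.lt_succ_self)) K (.of_succ_of_shortExact
        (tmap_injective hf Function.injective_id)
        (tmap_exact_left hfg hg) (tmap_surjective hg Function.surjective_id)
        (hA2 m n n.lt_succ_self) hA))
      (.of_projective (n + 1))

lemma right_extVanishes [IsNoetherianRing R2]
    (A1 : Type) [AddCommGroup A1] [Module k A1] [Module R1 A1] [IsScalarTower k R1 A1]
    [Module.Finite R1 A1] [Nontrivial (A1 →ₗ[R1] Y1)] (n : ℕ)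
    (hA1 : ∀ m : ℕ, ∀ j < n, ExtVanishes (R1 ⊗[k] R2) (A1 ⊗[k] (Fin m →₀ R2)) Y (j + 1))
    (A2 : Type) [AddCommGroup A2] [Module k A2] [Module R2 A2] [IsScalarTower k R2 A2]
    [Module.Finite R2 A2] (hA : ExtVanishes (R1 ⊗[k] R2) (A1 ⊗[k] A2) Y (n + 1)) :
    ExtVanishes R2 A2 Y2 (n + 1) := by
  induction n generalizing A2 with
  | zero =>
    obtain ⟨m, K, _, _, _, _, _, f, g, hf, hfg, hg⟩ := Module.Finite.exists_shortExact k R2 A2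
    exact .one_of_shortExact hf hfg hg
      (H.of_right (A := A1) f (ExtVanishes.lcomp_surjective
        (tmap_injective Function.injective_id hf)
        (tmap_exact_right hfg hg) (tmap_surjective Function.surjective_id hg) hA))
      (.of_projective 0)
  | succ n ih =>
    obtain ⟨m, K, _, _, _, _, _, f, g, hf, hfg, hg⟩ := Module.Finite.exists_shortExact k R2 A2
    exact .succ_of_shortExact hf hfg hg
      (ih (fun m j hj => hA1 m j (hj.trans n.lt_succ_self)) K (.of_succ_of_shortExact
        (tmap_injective Function.injective_id hf)
        (tmap_exact_right hfg hg) (tmap_surjective Function.surjective_id hg)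
        (hA1 m n n.lt_succ_self) hA))
      (.of_projective (n + 1))

theorem extVanishes_iff [IsNoetherianRing R1] [IsNoetherianRing R2]
    (A1 : Type) [AddCommGroup A1] [Module k A1] [Module R1 A1] [IsScalarTower k R1 A1]
    [Module.Finite R1 A1] [Nontrivial (A1 →ₗ[R1] Y1)]
    (A2 : Type) [AddCommGroup A2] [Module k A2] [Module R2 A2] [IsScalarTower k R2 A2]
    [Module.Finite R2 A2] [Nontrivial (A2 →ₗ[R2] Y2)] :
    (∀ n, ExtVanishes (R1 ⊗[k] R2) (A1 ⊗[k] A2) Y (n + 1)) ↔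
      (∀ n, ExtVanishes R1 A1 Y1 (n + 1)) ∧ ∀ n, ExtVanishes R2 A2 Y2 (n + 1) := by
  have free (m m' j : ℕ) :
      ExtVanishes (R1 ⊗[k] R2) ((Fin m →₀ R1) ⊗[k] (Fin m' →₀ R2)) Y (j + 1) :=
    have := tensorModule_finsupp_projective (k := k) (R1 := R1) (R2 := R2) (Fin m) (Fin m')
    .of_projective j
  refine ⟨fun h => forall_and.1 fun n => ?_, fun h n => ?_⟩
  · induction n using Nat.strong_induction_on with
    | _ n ih =>
      exact ⟨H.left_extVanishes A2 n (fun m j hj => H.extVanishes_of_right _ j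
          (fun m' i _ => free m m' i) A2 fun i hi => (ih i (hi.trans_lt hj)).2) A1 (h n),
        H.right_extVanishes A1 n (fun m j hj => H.extVanishes_of_left _ j
          (fun m' i _ => free m' m i) A1 fun i hi => (ih i (hi.trans_lt hj)).1) A2 (h n)⟩
  · exact H.extVanishes_of_left A2 n (fun m j _ => H.extVanishes_of_right _ j
      (fun m' i _ => free m m' i) A2 fun i _ => h.2 i) A1 fun i _ => h.1 i

end KunnethCompatible

end Kunneth

section HomTensor

lemma rTensor_joint_injective {k : Type} [Field k] {W X V ι : Type} [AddCommGroup W] [Module k W]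
    [AddCommGroup X] [Module k X] [AddCommGroup V] [Module k V] (e : ι → W →ₗ[k] X)
    (he : ∀ w, (∀ i, e i w = 0) → w = 0) (z : W ⊗[k] V) (hz : ∀ i, (e i).rTensor V z = 0) :
    z = 0 := by
  classical
  let b := Module.Basis.ofVectorSpace k V
  apply (TensorProduct.equivFinsuppOfBasisRight b).injective
  rw [map_zero]
  ext j
  refine he _ fun i => ?_
  have key : e i (TensorProduct.equivFinsuppOfBasisRight b z j) =
      TensorProduct.equivFinsuppOfBasisRight b ((e i).rTensor V z) j := by
    clear hz
    induction z using TensorProduct.induction_on with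
    | zero => simp
    | tmul w v => simp
    | add x y hx hy => simp_all
  rw [key, hz]
  simp

lemma lTensor_joint_injective {k : Type} [Field k] {W X V ι : Type} [AddCommGroup W] [Module k W]
    [AddCommGroup X] [Module k X] [AddCommGroup V] [Module k V] (e : ι → W →ₗ[k] X)
    (he : ∀ w, (∀ i, e i w = 0) → w = 0) (z : V ⊗[k] W) (hz : ∀ i, (e i).lTensor V z = 0) :
    z = 0 := by
  apply (TensorProduct.comm k V W).injective
  rw [map_zero]
  refine rTensor_joint_injective e he _ fun i => ?_
  rw [← LinearMap.comm_comp_lTensor_comp_comm_eq]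
  simp [hz]

variable {k : Type} [Field k]

lemma exists_rTensor_applyₗ_eq {S A X V : Type} [CommRing S] [Algebra k S]
    [AddCommGroup A] [Module S A] [Module.Finite S A]
    [AddCommGroup X] [Module k X] [Module S X] [IsScalarTower k S X]
    [AddCommGroup V] [Module k V] (h : A →ₗ[S] X ⊗[k] V) :
    ∃ z : (A →ₗ[S] X) ⊗[k] V, ∀ a, (LinearMap.applyₗ' k a).rTensor V z = h a := by
  classical
  let b := Module.Basis.ofVectorSpace k V
  let e := TensorProduct.equivFinsuppOfBasisRight (M := X) b
  let p (i) : X ⊗[k] V →ₗ[S] X := (TensorProduct.AlgebraTensorModule.rid k S X).toLinearMap ∘ₗ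
    TensorProduct.AlgebraTensorModule.lTensor S X (b.coord i)
  have hp (i) (x : X ⊗[k] V) : p i x = e x i :=
    (TensorProduct.equivFinsuppOfBasisRight_apply b x i).symm
  obtain ⟨T, hT⟩ := Module.Finite.fg_top (R := S) (M := A)
  let J := T.biUnion fun t => (e (h t)).support
  have hJ (i) (hi : i ∉ J) : p i ∘ₗ h = 0 := by
    refine LinearMap.ext_on hT fun t ht => ?_
    simp only [J, Finset.mem_biUnion, not_exists, not_and, Finsupp.mem_support_iff,
      not_not] at hi
    exact (hp i _).trans (hi t ht)
  refine ⟨∑ i ∈ J, (p i ∘ₗ h) ⊗ₜ b i, fun a => ?_⟩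
  rw [← e.symm_apply_apply (h a), TensorProduct.equivFinsuppOfBasisRight_symm_apply,
    Finsupp.sum_of_support_subset (s := J)]
  · simp [hp]
  · intro i hi
    by_contra hiJ
    exact Finsupp.mem_support_iff.1 hi ((hp i _).symm.trans (LinearMap.congr_fun (hJ i hiJ) a))
  · simp

variable {R1 R2 : Type} [CommRing R1] [CommRing R2] [Algebra k R1] [Algebra k R2]
  {A1 B1 M1 A2 B2 M2 : Type}
  [AddCommGroup A1] [Module k A1] [Module R1 A1] [IsScalarTower k R1 A1]
  [AddCommGroup B1] [Module k B1] [Module R1 B1] [IsScalarTower k R1 B1]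
  [AddCommGroup M1] [Module k M1] [Module R1 M1] [IsScalarTower k R1 M1]
  [AddCommGroup A2] [Module k A2] [Module R2 A2] [IsScalarTower k R2 A2]
  [AddCommGroup B2] [Module k B2] [Module R2 B2] [IsScalarTower k R2 B2]
  [AddCommGroup M2] [Module k M2] [Module R2 M2] [IsScalarTower k R2 M2]

lemma tensorProduct_linearMap_ext {X : Type} [AddCommMonoid X] [Module (R1 ⊗[k] R2) X]
    {f g : A1 ⊗[k] A2 →ₗ[R1 ⊗[k] R2] X} (h : ∀ a b, f (a ⊗ₜ b) = g (a ⊗ₜ b)) : f = g := by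
  ext x
  induction x using TensorProduct.induction_on with
  | zero => simp
  | tmul a b => exact h a b
  | add x y hx hy => simp [hx, hy]

variable (k R1 R2 A1 M1 A2 M2) in
/-- The additive comparison map from the tensor product of Hom modules to the Hom module between
tensor products. -/
noncomputable def homTensorAddHom : (A1 →ₗ[R1] M1) ⊗[k] (A2 →ₗ[R2] M2) →+
    (A1 ⊗[k] A2 →ₗ[R1 ⊗[k] R2] M1 ⊗[k] M2) :=
  TensorProduct.liftAddHom
    (AddMonoidHom.mk' (fun f => AddMonoidHom.mk' (fun g => tmap k f g)
        fun g g' => tensorProduct_linearMap_ext fun a b => by simp [tmul_add])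
      fun f f' => AddMonoidHom.ext fun g =>
        tensorProduct_linearMap_ext fun a b => by simp [add_tmul])
    fun c f g => tensorProduct_linearMap_ext fun a b => by
      simp [smul_tmul]

variable (k R1 R2 A1 M1 A2 M2) in
/-- The comparison map from the tensor product of Hom modules to the Hom module between tensor
products. -/
noncomputable def homTensor : (A1 →ₗ[R1] M1) ⊗[k] (A2 →ₗ[R2] M2) →ₗ[R1 ⊗[k] R2]
    (A1 ⊗[k] A2 →ₗ[R1 ⊗[k] R2] M1 ⊗[k] M2) :=
  AddMonoidHom.toTensorLinearMap (homTensorAddHom k R1 R2 A1 M1 A2 M2) <| by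
    intro r1 r2 x
    induction x using TensorProduct.induction_on with
    | zero => rw [smul_zero, map_zero, smul_zero]
    | tmul f g =>
      exact tensorProduct_linearMap_ext fun a b => rfl
    | add x y hx hy => rw [smul_add, map_add, hx, hy, map_add, smul_add]

@[simp]
lemma homTensor_tmul (f : A1 →ₗ[R1] M1) (g : A2 →ₗ[R2] M2) :
    homTensor k R1 R2 A1 M1 A2 M2 (f ⊗ₜ g) = tmap k f g := rfl

lemma homTensor_apply_tmul (z : (A1 →ₗ[R1] M1) ⊗[k] (A2 →ₗ[R2] M2)) (a : A1) (b : A2) :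
    homTensor k R1 R2 A1 M1 A2 M2 z (a ⊗ₜ b) =
      (LinearMap.applyₗ' k b).lTensor M1 ((LinearMap.applyₗ' k a).rTensor (A2 →ₗ[R2] M2) z) := by
  induction z using TensorProduct.induction_on with
  | zero => simp
  | tmul f g => simp
  | add x y hx hy => simp_all

lemma homTensor_injective : Function.Injective (homTensor k R1 R2 A1 M1 A2 M2) := by
  refine (injective_iff_map_eq_zero _).2 fun z hz => ?_
  refine rTensor_joint_injective (LinearMap.applyₗ' k) (fun f hf => LinearMap.ext hf) z fun a => ?_
  refine lTensor_joint_injective (LinearMap.applyₗ' k) (fun f hf => LinearMap.ext hf) _ fun b => ?_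
  rw [← homTensor_apply_tmul, hz]
  rfl

lemma homTensor_surjective [Module.Finite R1 A1] [Module.Finite R2 A2] :
    Function.Surjective (homTensor k R1 R2 A1 M1 A2 M2) := by
  intro h
  have key (a : A1) : ∃ z : M1 ⊗[k] (A2 →ₗ[R2] M2),
      ∀ b, (LinearMap.applyₗ' k b).lTensor M1 z = h (a ⊗ₜ b) := by
    let φ : A2 →ₗ[R2] M2 ⊗[k] M1 :=
      { toFun := fun b => TensorProduct.comm k M1 M2 (h (a ⊗ₜ b))
        map_add' := fun b b' => by simp [tmul_add]
        map_smul' := fun r b => by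
          have : (a ⊗ₜ[k] (r • b) : A1 ⊗[k] A2) = ((1 : R1) ⊗ₜ[k] r) • (a ⊗ₜ[k] b) := by
            simp [tensorModule_smul_tmul]
          rw [this, map_smul, tensorModule_smul_eq_map]
          generalize h (a ⊗ₜ b) = y
          induction y using TensorProduct.induction_on with
          | zero => simp
          | tmul x y => simp [smul_tmul']
          | add x y hx hy => simp_all }
    obtain ⟨z, hz⟩ := exists_rTensor_applyₗ_eq φ
    refine ⟨TensorProduct.comm k _ _ z, fun b => ?_⟩
    apply (TensorProduct.comm k M1 M2).injective
    refine Eq.trans ?_ (hz b)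
    rw [← LinearMap.comm_comp_lTensor_comp_comm_eq]
    simp
  choose Ψ hΨ using key
  have uniq (x y : M1 ⊗[k] (A2 →ₗ[R2] M2)) (hxy : ∀ b, (LinearMap.applyₗ' k b).lTensor M1 x =
      (LinearMap.applyₗ' k b).lTensor M1 y) : x = y := by
    rw [← sub_eq_zero]
    refine lTensor_joint_injective (LinearMap.applyₗ' k) (fun f hf => LinearMap.ext hf) _
      fun b => ?_
    rw [map_sub, hxy, sub_self]
  let Ψ' : A1 →ₗ[R1] M1 ⊗[k] (A2 →ₗ[R2] M2) :=
    { toFun := Ψ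
      map_add' := fun a a' => uniq _ _ fun b => by simp [hΨ, add_tmul]
      map_smul' := fun r a => uniq _ _ fun b => by
        have : ((r • a) ⊗ₜ[k] b : A1 ⊗[k] A2) = (r ⊗ₜ[k] (1 : R2)) • (a ⊗ₜ[k] b) := by
          simp [tensorModule_smul_tmul]
        rw [hΨ, this, map_smul, ← hΨ, tensorModule_smul_eq_map]
        generalize Ψ a = y
        induction y using TensorProduct.induction_on with
        | zero => simp
        | tmul x y => simp [smul_tmul']
        | add x y hx hy => simp_all }
  obtain ⟨w, hw⟩ := exists_rTensor_applyₗ_eq Ψ'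
  exact ⟨w, tensorProduct_linearMap_ext fun a b => by
    rw [homTensor_apply_tmul, hw]
    exact hΨ a b⟩

lemma homTensor_comp_tmap (f : B1 →ₗ[R1] A1) (g : B2 →ₗ[R2] A2)
    (z : (A1 →ₗ[R1] M1) ⊗[k] (A2 →ₗ[R2] M2)) :
    (tmap k f g).lcomp (R1 ⊗[k] R2) (M1 ⊗[k] M2) (homTensor k R1 R2 A1 M1 A2 M2 z) =
      homTensor k R1 R2 B1 M1 B2 M2 (tmap k (f.lcomp R1 M1) (g.lcomp R2 M2) z) := by
  induction z using TensorProduct.induction_on with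
  | zero => simp
  | tmul φ ψ => exact tensorProduct_linearMap_ext fun a b => rfl
  | add x y hx hy => rw [map_add, map_add, map_add, map_add, hx, hy]

end HomTensor

section TensorTensor

lemma TensorProduct.addHom_ext {R M N P : Type} [CommSemiring R] [AddCommMonoid M] [Module R M]
    [AddCommMonoid N] [Module R N] [AddCommMonoid P] {f g : M ⊗[R] N →+ P}
    (h : ∀ m n, f (m ⊗ₜ n) = g (m ⊗ₜ n)) : f = g := by
  ext x
  induction x using TensorProduct.induction_on with
  | zero => simp
  | tmul a b => exact h a b
  | add x y hx hy => simp [hx, hy]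

variable (k : Type) [Field k] (R1 R2 : Type) [CommRing R1] [CommRing R2] [Algebra k R1]
  [Algebra k R2] (A1 N1 A2 N2 : Type)
  [AddCommGroup A1] [Module k A1] [Module R1 A1] [IsScalarTower k R1 A1]
  [AddCommGroup N1] [Module k N1] [Module R1 N1] [IsScalarTower k R1 N1]
  [AddCommGroup A2] [Module k A2] [Module R2 A2] [IsScalarTower k R2 A2]
  [AddCommGroup N2] [Module k N2] [Module R2 N2] [IsScalarTower k R2 N2]

/-- The forward direction of `tensorInterchange`. -/
noncomputable def tensorInterchangeHom : (A1 ⊗[k] A2) ⊗[R1 ⊗[k] R2] (N1 ⊗[k] N2) →+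
    (A1 ⊗[R1] N1) ⊗[k] (A2 ⊗[R2] N2) :=
  let μ : A1 ⊗[k] A2 →ₗ[k] N1 ⊗[k] N2 →ₗ[k] (A1 ⊗[R1] N1) ⊗[k] (A2 ⊗[R2] N2) :=
    TensorProduct.map₂ ((TensorProduct.mk R1 A1 N1).restrictScalars₁₂ k k)
      ((TensorProduct.mk R2 A2 N2).restrictScalars₁₂ k k)
  TensorProduct.liftAddHom
    (AddMonoidHom.mk' (fun x => (μ x).toAddMonoidHom) fun x y => by ext; simp) <| by
      intro r x z
      change μ (r • x) z = μ x (r • z)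
      induction r using TensorProduct.induction_on with
      | zero => simp
      | add r s hr hs => simp [add_smul, hr, hs]
      | tmul r s =>
        induction x using TensorProduct.induction_on with
        | zero => simp
        | add x y hx hy => simp [hx, hy]
        | tmul a b =>
          induction z using TensorProduct.induction_on with
          | zero => simp
          | add x y hx hy => simp [hx, hy]
          | tmul c d => simp [μ, tensorModule_smul_tmul]

/-- The part of `tensorInterchangeInv` that concerns the second factors. -/
noncomputable def tensorInterchangeInvAux (a : A1) (n : N1) : A2 ⊗[R2] N2 →+
    (A1 ⊗[k] A2) ⊗[R1 ⊗[k] R2] (N1 ⊗[k] N2) :=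
  TensorProduct.liftAddHom
    (AddMonoidHom.mk' (fun b => AddMonoidHom.mk' (fun m => (a ⊗ₜ b) ⊗ₜ (n ⊗ₜ m))
        fun m m' => by simp [tmul_add])
      fun b b' => by ext; simp [tmul_add, add_tmul]) <| by
    intro r b m
    have h : ((1 : R1) ⊗ₜ[k] r) • (a ⊗ₜ[k] b) = a ⊗ₜ[k] (r • b) := by
      simp [tensorModule_smul_tmul]
    have h' : ((1 : R1) ⊗ₜ[k] r) • (n ⊗ₜ[k] m) = n ⊗ₜ[k] (r • m) := by
      simp [tensorModule_smul_tmul]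
    simp only [AddMonoidHom.mk'_apply, ← h, ← h', smul_tmul]

/-- The curried form of `tensorInterchangeInv`. -/
noncomputable def tensorInterchangeInvCurry : A1 ⊗[R1] N1 →+ A2 ⊗[R2] N2 →+
    (A1 ⊗[k] A2) ⊗[R1 ⊗[k] R2] (N1 ⊗[k] N2) :=
  TensorProduct.liftAddHom
    (AddMonoidHom.mk' (fun a => AddMonoidHom.mk' (fun n =>
          tensorInterchangeInvAux k R1 R2 A1 N1 A2 N2 a n)
        fun n n' => TensorProduct.addHom_ext fun b m => by
          simp [tensorInterchangeInvAux, add_tmul, tmul_add])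
      fun a a' => AddMonoidHom.ext fun n => TensorProduct.addHom_ext fun b m => by
        simp [tensorInterchangeInvAux, add_tmul]) <| by
    intro r a n
    refine TensorProduct.addHom_ext fun b m => ?_
    have h : (r ⊗ₜ[k] (1 : R2)) • (a ⊗ₜ[k] b) = (r • a) ⊗ₜ[k] b := by
      simp [tensorModule_smul_tmul]
    have h' : (r ⊗ₜ[k] (1 : R2)) • (n ⊗ₜ[k] m) = (r • n) ⊗ₜ[k] m := by
      simp [tensorModule_smul_tmul]
    simp only [AddMonoidHom.mk'_apply, tensorInterchangeInvAux, liftAddHom_tmul, ← h, ← h',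
      smul_tmul]

lemma tensorInterchangeInvCurry_tmul (a : A1) (b : A2) (n : N1) (m : N2) :
    tensorInterchangeInvCurry k R1 R2 A1 N1 A2 N2 (a ⊗ₜ n) (b ⊗ₜ m) =
      (a ⊗ₜ b) ⊗ₜ (n ⊗ₜ m) := rfl

/-- The inverse direction of `tensorInterchange`. -/
noncomputable def tensorInterchangeInv : (A1 ⊗[R1] N1) ⊗[k] (A2 ⊗[R2] N2) →+
    (A1 ⊗[k] A2) ⊗[R1 ⊗[k] R2] (N1 ⊗[k] N2) :=
  TensorProduct.liftAddHom (tensorInterchangeInvCurry k R1 R2 A1 N1 A2 N2) <| by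
    intro c x y
    induction x using TensorProduct.induction_on with
    | zero => rw [smul_zero, map_zero, AddMonoidHom.zero_apply, AddMonoidHom.zero_apply]
    | add x x' hx hx' =>
      rw [smul_add, map_add, map_add, AddMonoidHom.add_apply, AddMonoidHom.add_apply, hx, hx']
    | tmul a n =>
      induction y using TensorProduct.induction_on with
      | zero => rw [smul_zero, map_zero, map_zero]
      | add y y' hy hy' => rw [smul_add, map_add, map_add, hy, hy']
      | tmul b m =>
        rw [smul_tmul', smul_tmul', tensorInterchangeInvCurry_tmul,
          tensorInterchangeInvCurry_tmul, smul_tmul]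

@[simp]
lemma tensorInterchangeHom_tmul (a : A1) (b : A2) (n : N1) (m : N2) :
    tensorInterchangeHom k R1 R2 A1 N1 A2 N2 ((a ⊗ₜ b) ⊗ₜ (n ⊗ₜ m)) =
      (a ⊗ₜ n) ⊗ₜ (b ⊗ₜ m) := rfl

@[simp]
lemma tensorInterchangeInv_tmul (a : A1) (b : A2) (n : N1) (m : N2) :
    tensorInterchangeInv k R1 R2 A1 N1 A2 N2 ((a ⊗ₜ n) ⊗ₜ (b ⊗ₜ m)) =
      (a ⊗ₜ b) ⊗ₜ (n ⊗ₜ m) := rfl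

variable {k R1 R2 A1 N1 A2 N2} in
lemma tensorProduct_addHom_ext {X : Type} [AddCommMonoid X]
    {f g : (A1 ⊗[k] A2) ⊗[R1 ⊗[k] R2] (N1 ⊗[k] N2) →+ X}
    (h : ∀ a b n m, f ((a ⊗ₜ b) ⊗ₜ (n ⊗ₜ m)) = g ((a ⊗ₜ b) ⊗ₜ (n ⊗ₜ m))) : f = g := by
  refine TensorProduct.addHom_ext fun x y => ?_
  induction x using TensorProduct.induction_on with
  | zero => simp
  | add x x' hx hx' => simp [add_tmul, hx, hx']
  | tmul a b =>
    induction y using TensorProduct.induction_on with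
    | zero => simp
    | add x x' hx hx' => simp [tmul_add, hx, hx']
    | tmul n m => exact h a b n m

omit [Module k N1] [IsScalarTower k R1 N1] [Module k N2] [IsScalarTower k R2 N2] in
variable {k R1 R2 A1 N1 A2 N2} in
lemma tensorProduct_addHom_ext' {X : Type} [AddCommMonoid X]
    {f g : (A1 ⊗[R1] N1) ⊗[k] (A2 ⊗[R2] N2) →+ X}
    (h : ∀ a n b m, f ((a ⊗ₜ n) ⊗ₜ (b ⊗ₜ m)) = g ((a ⊗ₜ n) ⊗ₜ (b ⊗ₜ m))) : f = g := by
  refine TensorProduct.addHom_ext fun x y => ?_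
  induction x using TensorProduct.induction_on with
  | zero => simp
  | add x x' hx hx' => simp [add_tmul, hx, hx']
  | tmul a b =>
    induction y using TensorProduct.induction_on with
    | zero => simp
    | add x x' hx hx' => simp [tmul_add, hx, hx']
    | tmul n m => exact h a b n m

/-- The interchange isomorphism
`(A1 ⊗[k] A2) ⊗[R1 ⊗[k] R2] (N1 ⊗[k] N2) ≃ (A1 ⊗[R1] N1) ⊗[k] (A2 ⊗[R2] N2)`. -/
noncomputable def tensorInterchange : (A1 ⊗[k] A2) ⊗[R1 ⊗[k] R2] (N1 ⊗[k] N2) ≃+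
    (A1 ⊗[R1] N1) ⊗[k] (A2 ⊗[R2] N2) :=
  AddMonoidHom.toAddEquiv (tensorInterchangeHom k R1 R2 A1 N1 A2 N2)
    (tensorInterchangeInv k R1 R2 A1 N1 A2 N2)
    (tensorProduct_addHom_ext fun a b n m => by simp)
    (tensorProduct_addHom_ext' fun a n b m => by simp)

@[simp]
lemma tensorInterchange_tmul (a : A1) (b : A2) (n : N1) (m : N2) :
    tensorInterchange k R1 R2 A1 N1 A2 N2 ((a ⊗ₜ b) ⊗ₜ (n ⊗ₜ m)) =
      (a ⊗ₜ n) ⊗ₜ (b ⊗ₜ m) := rfl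

variable {B1 B2 : Type}
  [AddCommGroup B1] [Module k B1] [Module R1 B1] [IsScalarTower k R1 B1]
  [AddCommGroup B2] [Module k B2] [Module R2 B2] [IsScalarTower k R2 B2]

variable {k R1 R2 A1 A2} in
lemma tensorInterchange_rTensor_tmap (f : A1 →ₗ[R1] B1) (g : A2 →ₗ[R2] B2)
    (x : (A1 ⊗[k] A2) ⊗[R1 ⊗[k] R2] (N1 ⊗[k] N2)) :
    tensorInterchange k R1 R2 B1 N1 B2 N2 ((tmap k f g).rTensor (N1 ⊗[k] N2) x) =
      TensorProduct.map ((f.rTensor N1).restrictScalars k) ((g.rTensor N2).restrictScalars k)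
        (tensorInterchange k R1 R2 A1 N1 A2 N2 x) := by
  let φ : (A1 ⊗[k] A2) ⊗[R1 ⊗[k] R2] (N1 ⊗[k] N2) →+ (B1 ⊗[R1] N1) ⊗[k] (B2 ⊗[R2] N2) :=
    (tensorInterchange k R1 R2 B1 N1 B2 N2).toAddMonoidHom.comp
      ((tmap k f g).rTensor (N1 ⊗[k] N2)).toAddMonoidHom
  let ψ : (A1 ⊗[k] A2) ⊗[R1 ⊗[k] R2] (N1 ⊗[k] N2) →+ (B1 ⊗[R1] N1) ⊗[k] (B2 ⊗[R2] N2) :=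
    (TensorProduct.map ((f.rTensor N1).restrictScalars k)
      ((g.rTensor N2).restrictScalars k)).toAddMonoidHom.comp
        (tensorInterchange k R1 R2 A1 N1 A2 N2).toAddMonoidHom
  have : φ = ψ := tensorProduct_addHom_ext fun a b n m => by simp [φ, ψ]
  exact DFunLike.congr_fun this x

end TensorTensor

section FieldTensor

variable {k : Type} [Field k] {V V' W W' : Type} [AddCommGroup V] [Module k V] [AddCommGroup V']
  [Module k V'] [AddCommGroup W] [Module k W] [AddCommGroup W'] [Module k W']
  {f : V →ₗ[k] V'} {g : W →ₗ[k] W'}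

lemma surjective_left_of_tensorProduct_map [Nontrivial W']
    (h : Function.Surjective (TensorProduct.map f g)) : Function.Surjective f := by
  rw [← LinearMap.rTensor_comp_lTensor, LinearMap.coe_comp] at h
  exact (Module.FaithfullyFlat.lTensor_surjective_iff_surjective k W' f).1
    ((LinearMap.lTensor_surj_iff_rTensor_surj W' f).2 h.of_comp)

lemma surjective_right_of_tensorProduct_map [Nontrivial V']
    (h : Function.Surjective (TensorProduct.map f g)) : Function.Surjective g := by
  rw [← LinearMap.lTensor_comp_rTensor, LinearMap.coe_comp] at h
  exact (Module.FaithfullyFlat.lTensor_surjective_iff_surjective k V' g).1 h.of_comp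

lemma injective_left_of_tensorProduct_map [Nontrivial W]
    (h : Function.Injective (TensorProduct.map f g)) : Function.Injective f := by
  rw [← LinearMap.lTensor_comp_rTensor, LinearMap.coe_comp] at h
  exact (Module.FaithfullyFlat.lTensor_injective_iff_injective k W f).1
    ((LinearMap.lTensor_inj_iff_rTensor_inj W f).2 h.of_comp)

lemma injective_right_of_tensorProduct_map [Nontrivial V]
    (h : Function.Injective (TensorProduct.map f g)) : Function.Injective g := by
  rw [← LinearMap.rTensor_comp_lTensor, LinearMap.coe_comp] at h
  exact (Module.FaithfullyFlat.lTensor_injective_iff_injective k V g).1 h.of_comp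

lemma tensorProduct_map_bijective_iff [Nontrivial V'] [Nontrivial W'] :
    Function.Bijective (TensorProduct.map f g) ↔ Function.Bijective f ∧ Function.Bijective g := by
  refine ⟨fun h => ?_, fun ⟨hf, hg⟩ => ⟨TensorProduct.map_injective_of_flat_flat f g hf.1 hg.1,
    TensorProduct.map_surjective hf.2 hg.2⟩⟩
  have hf := surjective_left_of_tensorProduct_map h.2
  have hg := surjective_right_of_tensorProduct_map h.2
  have := hf.nontrivial
  have := hg.nontrivial
  exact ⟨⟨injective_left_of_tensorProduct_map h.1, hf⟩,
    ⟨injective_right_of_tensorProduct_map h.1, hg⟩⟩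

end FieldTensor

section Compatibility

lemma nontrivial_hom_character_iff {R N A : Type} [CommRing R] [AddCommGroup N] [Module R N]
    [AddCommGroup A] [Module R A] :
    Nontrivial (A →ₗ[R] CharacterModule N) ↔ Nontrivial (A ⊗[R] N) := by
  rw [(homCharacterEquiv N A).toEquiv.nontrivial_congr,
    (TensorProduct.comm R A N).toEquiv.nontrivial_congr]
  refine ⟨fun h => ?_, fun h => ?_⟩
  · by_contra hN
    rw [not_nontrivial_iff_subsingleton] at hN
    obtain ⟨x, y, hxy⟩ := h
    exact hxy (DFunLike.ext _ _ fun a => by rw [Subsingleton.elim a 0, map_zero, map_zero])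
  · obtain ⟨x, hx⟩ := exists_ne (0 : N ⊗[R] A)
    obtain ⟨c, hc⟩ := CharacterModule.exists_character_apply_ne_zero_of_ne_zero hx
    exact ⟨c, 0, fun h => hc (by rw [h]; rfl)⟩

variable (k : Type) [Field k] (R1 R2 : Type) [CommRing R1] [CommRing R2] [Algebra k R1]
  [Algebra k R2] (M1 M2 : Type)
  [AddCommGroup M1] [Module k M1] [Module R1 M1] [IsScalarTower k R1 M1]
  [AddCommGroup M2] [Module k M2] [Module R2 M2] [IsScalarTower k R2 M2]

lemma kunnethCompatible_tensor : KunnethCompatible k R1 R2 M1 M2 (M1 ⊗[k] M2) where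
  left {K F A} _ _ _ _ _ _ _ _ _ _ _ _ _ _ _ f hf h := by
    obtain ⟨z, rfl⟩ := homTensor_surjective h
    obtain ⟨w, rfl⟩ := tmap_surjective (k := k) hf
      (show Function.Surjective ((LinearMap.id : A →ₗ[R2] A).lcomp R2 M2) from fun g => ⟨g, rfl⟩) z
    exact ⟨homTensor k R1 R2 F M1 A M2 w, homTensor_comp_tmap f LinearMap.id w⟩
  of_left {K F A} _ _ _ _ _ _ _ _ _ _ _ _ _ _ _ _ f hf := by
    refine surjective_left_of_tensorProduct_map (k := k) (f := (f.lcomp R1 M1).restrictScalars k)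
      (g := ((LinearMap.id : A →ₗ[R2] A).lcomp R2 M2).restrictScalars k) fun z => ?_
    obtain ⟨h, hh⟩ := hf (homTensor k R1 R2 K M1 A M2 z)
    obtain ⟨w, rfl⟩ := homTensor_surjective h
    exact ⟨w, homTensor_injective ((homTensor_comp_tmap f LinearMap.id w).symm.trans hh)⟩
  right {K F A} _ _ _ _ _ _ _ _ _ _ _ _ _ _ _ f hf h := by
    obtain ⟨z, rfl⟩ := homTensor_surjective h
    obtain ⟨w, rfl⟩ := tmap_surjective (k := k)
      (show Function.Surjective ((LinearMap.id : A →ₗ[R1] A).lcomp R1 M1) from fun g => ⟨g, rfl⟩)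
      hf z
    exact ⟨homTensor k R1 R2 A M1 F M2 w, homTensor_comp_tmap LinearMap.id f w⟩
  of_right {K F A} _ _ _ _ _ _ _ _ _ _ _ _ _ _ _ _ f hf := by
    refine surjective_right_of_tensorProduct_map (k := k)
      (f := ((LinearMap.id : A →ₗ[R1] A).lcomp R1 M1).restrictScalars k)
      (g := (f.lcomp R2 M2).restrictScalars k) fun z => ?_
    obtain ⟨h, hh⟩ := hf (homTensor k R1 R2 A M1 K M2 z)
    obtain ⟨w, rfl⟩ := homTensor_surjective h
    exact ⟨w, homTensor_injective ((homTensor_comp_tmap LinearMap.id f w).symm.trans hh)⟩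

variable {k R1 R2} in
lemma rTensor_tmap_injective_iff {A1 B1 A2 B2 : Type}
    [AddCommGroup A1] [Module k A1] [Module R1 A1] [IsScalarTower k R1 A1]
    [AddCommGroup B1] [Module k B1] [Module R1 B1] [IsScalarTower k R1 B1]
    [AddCommGroup A2] [Module k A2] [Module R2 A2] [IsScalarTower k R2 A2]
    [AddCommGroup B2] [Module k B2] [Module R2 B2] [IsScalarTower k R2 B2]
    (f : A1 →ₗ[R1] B1) (g : A2 →ₗ[R2] B2) :
    Function.Injective ((tmap k f g).rTensor (M1 ⊗[k] M2)) ↔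
      Function.Injective (TensorProduct.map ((f.rTensor M1).restrictScalars k)
        ((g.rTensor M2).restrictScalars k)) := by
  rw [← (tensorInterchange k R1 R2 B1 M1 B2 M2).injective.of_comp_iff,
    ← Function.Injective.of_comp_iff' _ (tensorInterchange k R1 R2 A1 M1 A2 M2).bijective]
  exact iff_of_eq (congrArg _ (funext fun x => tensorInterchange_rTensor_tmap M1 M2 f g x))

lemma kunnethCompatible_character :
    KunnethCompatible k R1 R2 (CharacterModule M1) (CharacterModule M2)
      (CharacterModule (M1 ⊗[k] M2)) where
  left {K F A} _ _ _ _ _ _ _ _ _ _ _ _ _ _ _ f hf := by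
    rw [← rTensor_injective_iff_lcomp_surjective] at hf ⊢
    rw [rTensor_tmap_injective_iff, LinearMap.rTensor_id]
    exact TensorProduct.map_injective_of_flat_flat _ _ hf Function.injective_id
  of_left {K F A} _ _ _ _ _ _ _ _ _ _ _ _ _ _ _ hA f hf := by
    have := nontrivial_hom_character_iff.1 hA
    rw [← rTensor_injective_iff_lcomp_surjective] at hf ⊢
    rw [rTensor_tmap_injective_iff] at hf
    exact injective_left_of_tensorProduct_map hf
  right {K F A} _ _ _ _ _ _ _ _ _ _ _ _ _ _ _ f hf := by
    rw [← rTensor_injective_iff_lcomp_surjective] at hf ⊢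
    rw [rTensor_tmap_injective_iff, LinearMap.rTensor_id]
    exact TensorProduct.map_injective_of_flat_flat _ _ Function.injective_id hf
  of_right {K F A} _ _ _ _ _ _ _ _ _ _ _ _ _ _ _ hA f hf := by
    have := nontrivial_hom_character_iff.1 hA
    rw [← rTensor_injective_iff_lcomp_surjective] at hf ⊢
    rw [rTensor_tmap_injective_iff] at hf
    exact injective_right_of_tensorProduct_map hf

end Compatibility

section BassClass

/-- The evaluation map `N ⊗[R] (N →ₗ[R] M) → M`. -/
noncomputable abbrev homEvaluation (R N M : Type) [CommRing R] [AddCommGroup N] [Module R N]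
    [AddCommGroup M] [Module R M] : N ⊗[R] (N →ₗ[R] M) →ₗ[R] M :=
  TensorProduct.lift (LinearMap.id : (N →ₗ[R] M) →ₗ[R] (N →ₗ[R] M)).flip

lemma memBassClass_iff {R N M : Type} [CommRing R] [AddCommGroup N] [Module R N]
    [AddCommGroup M] [Module R M] :
    MemBassClass R N M ↔ Function.Bijective (homEvaluation R N M) ∧
      (∀ n, ExtVanishes R N M (n + 1)) ∧
      ∀ n, ExtVanishes R (N →ₗ[R] M) (CharacterModule N) (n + 1) := by
  have (p : ℕ → Prop) : (∀ i, 0 < i → p i) ↔ ∀ n, p (n + 1) :=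
    ⟨fun h n => h _ n.succ_pos, fun h i hi => by
      obtain ⟨n, rfl⟩ := Nat.exists_eq_succ_of_ne_zero hi.ne'
      exact h n⟩
  simp only [MemBassClass, this, subsingleton_extGroup_succ_iff, subsingleton_torGroup_succ_iff]

lemma nontrivial_tensor_hom_of_bijective {R N M : Type} [CommRing R] [AddCommGroup N] [Module R N]
    [AddCommGroup M] [Module R M] [Nontrivial M] (h : Function.Bijective (homEvaluation R N M)) :
    Nontrivial (N →ₗ[R] M) ∧ Nontrivial ((N →ₗ[R] M) →ₗ[R] CharacterModule N) := by
  have := h.2.nontrivial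
  rw [nontrivial_hom_character_iff]
  refine ⟨?_, (TensorProduct.comm R N (N →ₗ[R] M)).symm.toEquiv.nontrivial⟩
  by_contra hH
  rw [not_nontrivial_iff_subsingleton] at hH
  exact not_subsingleton (N ⊗[R] (N →ₗ[R] M)) inferInstance

variable {k : Type} [Field k] {R1 R2 : Type} [CommRing R1] [CommRing R2] [Algebra k R1]
  [Algebra k R2] {M1 N1 M2 N2 : Type}
  [AddCommGroup M1] [Module k M1] [Module R1 M1] [IsScalarTower k R1 M1]
  [AddCommGroup N1] [Module k N1] [Module R1 N1] [IsScalarTower k R1 N1]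
  [AddCommGroup M2] [Module k M2] [Module R2 M2] [IsScalarTower k R2 M2]
  [AddCommGroup N2] [Module k N2] [Module R2 N2] [IsScalarTower k R2 N2]

lemma homEvaluation_lTensor_homTensor
    (x : (N1 ⊗[k] N2) ⊗[R1 ⊗[k] R2] ((N1 →ₗ[R1] M1) ⊗[k] (N2 →ₗ[R2] M2))) :
    homEvaluation (R1 ⊗[k] R2) (N1 ⊗[k] N2) (M1 ⊗[k] M2)
        ((homTensor k R1 R2 N1 M1 N2 M2).lTensor (N1 ⊗[k] N2) x) =
      TensorProduct.map ((homEvaluation R1 N1 M1).restrictScalars k)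
        ((homEvaluation R2 N2 M2).restrictScalars k)
        (tensorInterchange k R1 R2 N1 (N1 →ₗ[R1] M1) N2 (N2 →ₗ[R2] M2) x) := by
  let φ : (N1 ⊗[k] N2) ⊗[R1 ⊗[k] R2] ((N1 →ₗ[R1] M1) ⊗[k] (N2 →ₗ[R2] M2)) →+ M1 ⊗[k] M2 :=
    (homEvaluation (R1 ⊗[k] R2) (N1 ⊗[k] N2) (M1 ⊗[k] M2)).toAddMonoidHom.comp
      ((homTensor k R1 R2 N1 M1 N2 M2).lTensor (N1 ⊗[k] N2)).toAddMonoidHom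
  let ψ : (N1 ⊗[k] N2) ⊗[R1 ⊗[k] R2] ((N1 →ₗ[R1] M1) ⊗[k] (N2 →ₗ[R2] M2)) →+ M1 ⊗[k] M2 :=
    (TensorProduct.map ((homEvaluation R1 N1 M1).restrictScalars k)
      ((homEvaluation R2 N2 M2).restrictScalars k)).toAddMonoidHom.comp
      (tensorInterchange k R1 R2 N1 (N1 →ₗ[R1] M1) N2 (N2 →ₗ[R2] M2)).toAddMonoidHom
  have : φ = ψ := tensorProduct_addHom_ext fun a b n m => rfl
  exact DFunLike.congr_fun this x

lemma homEvaluation_tensor_bijective_iff [Module.Finite R1 N1] [Module.Finite R2 N2]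
    [Nontrivial M1] [Nontrivial M2] :
    Function.Bijective (homEvaluation (R1 ⊗[k] R2) (N1 ⊗[k] N2) (M1 ⊗[k] M2)) ↔
      Function.Bijective (homEvaluation R1 N1 M1) ∧
        Function.Bijective (homEvaluation R2 N2 M2) := by
  let e := LinearEquiv.ofBijective (homTensor k R1 R2 N1 M1 N2 M2)
    ⟨homTensor_injective, homTensor_surjective⟩
  rw [← Function.Bijective.of_comp_iff _ (e.lTensor (N1 ⊗[k] N2)).bijective]
  refine Iff.trans (iff_of_eq (congrArg _ (funext homEvaluation_lTensor_homTensor))) ?_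
  exact (Function.Bijective.of_comp_iff _ (tensorInterchange k R1 R2 _ _ _ _).bijective).trans
    tensorProduct_map_bijective_iff

lemma memBassClass_tensor_iff [IsNoetherianRing R1] [IsNoetherianRing R2]
    [Module.Finite R1 N1] [Module.Finite R2 N2] [Module.Finite R1 M1] [Module.Finite R2 M2]
    [Nontrivial M1] [Nontrivial M2] :
    MemBassClass (R1 ⊗[k] R2) (N1 ⊗[k] N2) (M1 ⊗[k] M2) ↔
      MemBassClass R1 N1 M1 ∧ MemBassClass R2 N2 M2 := by
  rw [memBassClass_iff, memBassClass_iff, memBassClass_iff, homEvaluation_tensor_bijective_iff]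
  refine Iff.trans (and_congr_right fun ⟨h1, h2⟩ => ?_) and_and_and_comm
  obtain ⟨_, _⟩ := nontrivial_tensor_hom_of_bijective h1
  obtain ⟨_, _⟩ := nontrivial_tensor_hom_of_bijective h2
  rw [(kunnethCompatible_tensor k R1 R2 M1 M2).extVanishes_iff N1 N2]
  refine Iff.trans (and_congr_right fun _ => ?_) and_and_and_comm
  rw [← (kunnethCompatible_character k R1 R2 N1 N2).extVanishes_iff (N1 →ₗ[R1] M1) (N2 →ₗ[R2] M2)]
  let e := LinearEquiv.ofBijective (homTensor k R1 R2 N1 M1 N2 M2)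
    ⟨homTensor_injective, homTensor_surjective⟩
  exact forall_congr' fun n => ⟨.of_linearEquiv e.symm (.refl _ _), .of_linearEquiv e (.refl _ _)⟩

lemma IsSemidualizing.nontrivial {R C : Type} [CommRing R] [Nontrivial R] [AddCommGroup C]
    [Module R C] (h : IsSemidualizing R C) : Nontrivial C := by
  by_contra hC
  rw [not_nontrivial_iff_subsingleton] at hC
  exact one_ne_zero (h.2.1.1 (LinearMap.ext fun x => Subsingleton.elim _ _) : (1 : R) = 0)

end BassClass

open TensorProduct in
/-- Let `k` be a field, `R1`, `R2` nonzero commutative noetherian `k`-algebras, and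
`M1, N1` (resp. `M2, N2`) semidualizing modules over `R1` (resp. `R2`).  Writing
`B ≈ C` for `B ∈ B_C(R)` and `C ∈ B_B(R)`, one has
`M1 ⊗[k] M2 ≈ N1 ⊗[k] N2` over `R1 ⊗[k] R2` iff `M1 ≈ N1` over `R1` and
`M2 ≈ N2` over `R2`. -/
theorem tensorProduct_bass_equiv_iff
    (k : Type) [Field k] (R1 R2 : Type) [CommRing R1] [CommRing R2]
    [Algebra k R1] [Algebra k R2] [Nontrivial R1] [Nontrivial R2]
    [IsNoetherianRing R1] [IsNoetherianRing R2]
    (M1 N1 : Type) [AddCommGroup M1] [Module k M1] [Module R1 M1] [IsScalarTower k R1 M1]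
    [AddCommGroup N1] [Module k N1] [Module R1 N1] [IsScalarTower k R1 N1]
    (M2 N2 : Type) [AddCommGroup M2] [Module k M2] [Module R2 M2] [IsScalarTower k R2 M2]
    [AddCommGroup N2] [Module k N2] [Module R2 N2] [IsScalarTower k R2 N2]
    (hM1 : IsSemidualizing R1 M1) (hN1 : IsSemidualizing R1 N1)
    (hM2 : IsSemidualizing R2 M2) (hN2 : IsSemidualizing R2 N2) :
    (MemBassClass (R1 ⊗[k] R2) (N1 ⊗[k] N2) (M1 ⊗[k] M2) ∧
        MemBassClass (R1 ⊗[k] R2) (M1 ⊗[k] M2) (N1 ⊗[k] N2)) ↔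
      ((MemBassClass R1 N1 M1 ∧ MemBassClass R1 M1 N1) ∧
        (MemBassClass R2 N2 M2 ∧ MemBassClass R2 M2 N2)) := by
  have := hM1.1
  have := hN1.1
  have := hM2.1
  have := hN2.1
  have := hM1.nontrivial
  have := hN1.nontrivial
  have := hM2.nontrivial
  have := hN2.nontrivial
  rw [memBassClass_tensor_iff, memBassClass_tensor_iff, and_and_and_comm]
end

section
/- Let k be a field and let X', X'', Y', Y'' be chain complexes of k-vector spaces with chain maps α': X' → Y' and α'': X'' → Y''. If α' and α'' are isomorphisms of complexes, then α' ⊗ α'': X' ⊗_k X'' → Y' ⊗_k Y'' is an isomorphism of complexes. Conversely, if X', X'', Y', Y'' are all nonzero complexes and α' ⊗ α'' is an isomorphism, then α' and α'' are isomorphisms. -/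
open CategoryTheory MonoidalCategory Limits

instance curriedTensorAdditive {C : Type*} [Category C] [MonoidalCategory C] [Preadditive C]
    [MonoidalPreadditive C] : (curriedTensor C).Additive where
  map_add {X Y f g} := by
    ext Z
    apply MonoidalPreadditive.add_whiskerRight

namespace HomologicalComplex

section Bifunctor

variable {C₁ C₂ D I₁ I₂ J : Type*} [Category C₁] [Category C₂] [Category D]
  [HasZeroMorphisms C₁] [HasZeroMorphisms C₂] [Preadditive D] [DecidableEq J]
  {c₁ : ComplexShape I₁} {c₂ : ComplexShape I₂}
  {K₁ L₁ : HomologicalComplex C₁ c₁} {K₂ L₂ : HomologicalComplex C₂ c₂}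
  {F : C₁ ⥤ C₂ ⥤ D} [F.PreservesZeroMorphisms] [∀ X₁, (F.obj X₁).PreservesZeroMorphisms]
  {c : ComplexShape J} [TotalComplexShape c₁ c₂ c]
  [HasMapBifunctor K₁ K₂ F c] [HasMapBifunctor L₁ L₂ F c]

/-- A morphism induced by a bifunctor on isomorphisms of complexes is an isomorphism. -/
theorem isIso_mapBifunctorMap (f₁ : K₁ ⟶ L₁) (f₂ : K₂ ⟶ L₂) [IsIso f₁] [IsIso f₂] :
    IsIso (mapBifunctorMap f₁ f₂ F c) := by
  refine ⟨mapBifunctorMap (inv f₁) (inv f₂) F c, ?_, ?_⟩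
  all_goals
    ext j i₁ i₂ h
    simp only [comp_f, id_f, ι_mapBifunctorMap_assoc, ι_mapBifunctorMap,
      NatTrans.naturality_assoc, ← Functor.map_comp_assoc, ← NatTrans.comp_app_assoc,
      ← Functor.map_comp]
    simp

variable (K₁ K₂ F c) in
open Classical in
/-- The projection onto a summand of `(mapBifunctor K₁ K₂ F c).X j`. -/
noncomputable def πMapBifunctor (i₁ : I₁) (i₂ : I₂) (j : J) :
    (mapBifunctor K₁ K₂ F c).X j ⟶ (F.obj (K₁.X i₁)).obj (K₂.X i₂) :=
  mapBifunctorDesc fun i₁' i₂' _ ↦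
    if h : i₁' = i₁ ∧ i₂' = i₂ then eqToHom (by rw [h.1, h.2]) else 0

theorem ι_πMapBifunctor (i₁ : I₁) (i₂ : I₂) (j : J)
    (h : ComplexShape.π c₁ c₂ c (i₁, i₂) = j) :
    ιMapBifunctor K₁ K₂ F c i₁ i₂ j h ≫ πMapBifunctor K₁ K₂ F c i₁ i₂ j = 𝟙 _ := by
  simp [πMapBifunctor]

theorem mapBifunctorMap_π (f₁ : K₁ ⟶ L₁) (f₂ : K₂ ⟶ L₂) (i₁ : I₁) (i₂ : I₂) (j : J) :
    (mapBifunctorMap f₁ f₂ F c).f j ≫ πMapBifunctor L₁ L₂ F c i₁ i₂ j =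
      πMapBifunctor K₁ K₂ F c i₁ i₂ j ≫
        (F.map (f₁.f i₁)).app (K₂.X i₂) ≫ (F.obj (L₁.X i₁)).map (f₂.f i₂) := by
  apply mapBifunctor.hom_ext
  intro i₁' i₂' h
  by_cases hi : i₁' = i₁ ∧ i₂' = i₂
  · obtain ⟨rfl, rfl⟩ := hi
    simp [πMapBifunctor]
  · simp [πMapBifunctor, hi]

/-- If the morphism of complexes induced by a bifunctor is an isomorphism, then so is each of its
components, being a retract of it in the corresponding degree. -/
theorem isIso_of_isIso_mapBifunctorMap (f₁ : K₁ ⟶ L₁) (f₂ : K₂ ⟶ L₂)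
    [IsIso (mapBifunctorMap f₁ f₂ F c)] (i₁ : I₁) (i₂ : I₂) :
    IsIso ((F.map (f₁.f i₁)).app (K₂.X i₂) ≫ (F.obj (L₁.X i₁)).map (f₂.f i₂)) := by
  let j := ComplexShape.π c₁ c₂ c (i₁, i₂)
  let r : RetractArrow ((F.map (f₁.f i₁)).app (K₂.X i₂) ≫ (F.obj (L₁.X i₁)).map (f₂.f i₂))
      ((mapBifunctorMap f₁ f₂ F c).f j) :=
    { i := Arrow.homMk (ιMapBifunctor K₁ K₂ F c i₁ i₂ j rfl)
        (ιMapBifunctor L₁ L₂ F c i₁ i₂ j rfl) (by simp)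
      r := Arrow.homMk (πMapBifunctor K₁ K₂ F c i₁ i₂ j)
        (πMapBifunctor L₁ L₂ F c i₁ i₂ j) (mapBifunctorMap_π f₁ f₂ i₁ i₂ j).symm
      retract := by
        ext
        · exact ι_πMapBifunctor i₁ i₂ j rfl
        · exact ι_πMapBifunctor i₁ i₂ j rfl }
  exact (MorphismProperty.isomorphisms D).of_retract r
    (inferInstanceAs (IsIso ((mapBifunctorMap f₁ f₂ F c).f j)))

end Bifunctor

theorem exists_nontrivial_of_not_isZero {R ι : Type*} [Ring R] {c : ComplexShape ι}
    {K : HomologicalComplex (ModuleCat R) c} (hK : ¬ IsZero K) : ∃ i, Nontrivial (K.X i) := by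
  contrapose! hK
  rw [IsZero.iff_id_eq_zero]
  ext i : 1
  exact (@ModuleCat.isZero_of_subsingleton _ _ (K.X i) (hK i)).eq_of_src _ _

end HomologicalComplex

namespace TensorProduct

variable {k M M' N N' : Type*} [Field k] [AddCommGroup M] [AddCommGroup M'] [AddCommGroup N]
  [AddCommGroup N'] [Module k M] [Module k M'] [Module k N] [Module k N']
  {f : M →ₗ[k] M'} {g : N →ₗ[k] N'}

theorem bijective_right_of_bijective_map [Nontrivial M] [Nontrivial M']
    (h : Function.Bijective (map f g)) : Function.Bijective g := by
  constructor
  · have h1 := h.1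
    rw [← LinearMap.rTensor_comp_lTensor, LinearMap.coe_comp] at h1
    exact (Module.FaithfullyFlat.lTensor_injective_iff_injective k M g).1 h1.of_comp
  · have h2 := h.2
    rw [← LinearMap.lTensor_comp_rTensor, LinearMap.coe_comp] at h2
    exact (Module.FaithfullyFlat.lTensor_surjective_iff_surjective k M' g).1 h2.of_comp

theorem bijective_left_of_bijective_map [Nontrivial N] [Nontrivial N']
    (h : Function.Bijective (map f g)) : Function.Bijective f := by
  refine bijective_right_of_bijective_map (f := g) (g := f) ?_
  have : map g f = (TensorProduct.comm k M' N').toLinearMap ∘ₗ map f g ∘ₗ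
      (TensorProduct.comm k N M).toLinearMap := by
    ext; simp
  rw [this]
  simpa using h

end TensorProduct

/-- Let `k` be a field and `X'`, `X''`, `Y'`, `Y''` complexes of `k`-vector spaces with
chain maps `α' : X' → Y'` and `α'' : X'' → Y''`.  If `α'` and `α''` are isomorphisms of
complexes then so is `α' ⊗ α''`; conversely, if `X'`, `X''`, `Y'`, `Y''` are all nonzero
and `α' ⊗ α''` is an isomorphism, then `α'` and `α''` are isomorphisms. -/
theorem tensorHom_isIso_iff (k : Type) [Field k]
    (X' X'' Y' Y'' : CochainComplex (ModuleCat k) ℤ)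
    (α' : X' ⟶ Y') (α'' : X'' ⟶ Y'') :
    (IsIso α' → IsIso α'' → IsIso (HomologicalComplex.tensorHom α' α'')) ∧
    (¬ IsZero X' → ¬ IsZero X'' → ¬ IsZero Y' → ¬ IsZero Y'' →
      IsIso (HomologicalComplex.tensorHom α' α'') → IsIso α' ∧ IsIso α'') := by
  refine ⟨fun _ _ ↦ HomologicalComplex.isIso_mapBifunctorMap α' α'', fun hX' hX'' _ _ hα ↦ ?_⟩
  have bij (p q : ℤ) : Function.Bijective (TensorProduct.map (α'.f p).hom (α''.f q).hom) := by
    have := HomologicalComplex.isIso_of_isIso_mapBifunctorMap α' α''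
      (F := curriedTensor (ModuleCat k)) (c := ComplexShape.up ℤ) p q
    have := (ConcreteCategory.isIso_iff_bijective _).1 this
    rw [← LinearMap.lTensor_comp_rTensor]
    exact this
  obtain ⟨p, hp⟩ := HomologicalComplex.exists_nontrivial_of_not_isZero hX'
  obtain ⟨q, hq⟩ := HomologicalComplex.exists_nontrivial_of_not_isZero hX''
  have hY := (bij p q).1.nontrivial
  have hYp : Nontrivial (Y'.X p) := by
    by_contra h
    rw [not_nontrivial_iff_subsingleton] at h
    exact not_subsingleton (TensorProduct k (Y'.X p) (Y''.X q)) inferInstance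
  have hYq : Nontrivial (Y''.X q) := by
    by_contra h
    rw [not_nontrivial_iff_subsingleton] at h
    exact not_subsingleton (TensorProduct k (Y'.X p) (Y''.X q)) inferInstance
  have h' (i : ℤ) : IsIso (α'.f i) := (ConcreteCategory.isIso_iff_bijective _).2
    (TensorProduct.bijective_left_of_bijective_map (bij i q))
  have h'' (i : ℤ) : IsIso (α''.f i) := (ConcreteCategory.isIso_iff_bijective _).2
    (TensorProduct.bijective_right_of_bijective_map (bij p i))
  exact ⟨HomologicalComplex.Hom.isIso_of_components _, HomologicalComplex.Hom.isIso_of_components _⟩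
end

section
/- Let k be a field and let A', B', A'', B'' be chain complexes of k-vector spaces with chain maps α': A' → B' and α'': A'' → B''. If α' and α'' are quasi-isomorphisms, then α' ⊗ α'': A' ⊗_k A'' → B' ⊗_k B'' is a quasi-isomorphism. Conversely, if none of A', B', A'', B'' is acyclic and α' ⊗ α'' is a quasi-isomorphism, then α' and α'' are quasi-isomorphisms. -/
open CategoryTheory MonoidalCategory Limits

variable (k : Type) [Field k]

/-- A complex of `k`-vector spaces is acyclic if all of its homology vanishes. -/
noncomputable def IsAcyclic (K : CochainComplex (ModuleCat k) ℤ) : Prop :=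
  ∀ i : ℤ, IsZero (K.homology i)

/-- A complex of `k`-vector spaces is homologically bounded if its homology vanishes
in all but finitely many degrees. -/
noncomputable def IsHomologicallyBounded (K : CochainComplex (ModuleCat k) ℤ) : Prop :=
  {i : ℤ | ¬ IsZero (K.homology i)}.Finite

theorem ModuleCat.exists_comp_comp_eq {F : Type*} [Field F] {X Y : ModuleCat F} (f : X ⟶ Y) :
    ∃ s : Y ⟶ X, f ≫ s ≫ f = f := by
  obtain ⟨r, hr⟩ := f.hom.rangeRestrict.exists_rightInverse_of_surjective f.hom.range_rangeRestrict
  obtain ⟨s, hs⟩ := r.exists_extend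
  refine ⟨ModuleCat.ofHom s, ?_⟩
  ext x
  have h1 : s (f.hom x) = r (f.hom.rangeRestrict x) :=
    LinearMap.congr_fun hs (f.hom.rangeRestrict x)
  have h2 := congrArg Subtype.val (LinearMap.congr_fun hr (f.hom.rangeRestrict x))
  simp only [ModuleCat.hom_comp, LinearMap.comp_apply, ModuleCat.hom_ofHom]
  rw [h1]
  exact h2

namespace HomologicalComplex

section

variable {C ι : Type*} [Category* C] [Abelian C] {c : ComplexShape ι}

/-- The homology of a complex, as a complex with zero differential. -/
noncomputable def homologyComplex (K : HomologicalComplex C c) : HomologicalComplex C c where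
  X i := K.homology i
  d _ _ := 0

/-- If the identity of a complex is homotopic to an endomorphism `e` which composes to zero with
the differentials, then the complex is homotopy equivalent to its homology. -/
noncomputable def homotopyEquivHomologyComplex (K : HomologicalComplex C c) (e : K ⟶ K)
    (h : Homotopy e (𝟙 K)) (he : ∀ i j, e.f i ≫ K.d i j = 0) :
    HomotopyEquiv K K.homologyComplex where
  hom :=
    { f i := K.liftCycles (e.f i) _ rfl (he _ _) ≫ K.homologyπ i
      comm' i j _ := by
        have : K.d i j ≫ K.liftCycles (e.f j) _ rfl (he _ _) = 0 := by
          rw [← cancel_mono (K.iCycles j)]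
          simp [← e.comm, he]
        simp [homologyComplex, reassoc_of% this] }
  inv :=
    { f i := K.homologyι i ≫ K.descOpcycles (e.f i) _ rfl (by rw [← e.comm, he])
      comm' i j _ := by
        have : K.descOpcycles (e.f i) _ rfl (by rw [← e.comm, he]) ≫ K.d i j = 0 := by
          rw [← cancel_epi (K.pOpcycles i)]
          simp [he]
        simp [homologyComplex, this] }
  homotopyHomInvId := (Homotopy.ofEq (by
    ext i
    change (K.liftCycles (e.f i) _ rfl _ ≫ K.homologyπ i) ≫ K.homologyι i ≫
      K.descOpcycles (e.f i) _ rfl _ = e.f i ≫ e.f i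
    simp)).trans ((h.comp h).trans (Homotopy.ofEq (by simp)))
  homotopyInvHomId := Homotopy.ofEq (by
    ext i
    change (K.homologyι i ≫ K.descOpcycles (e.f i) _ rfl _) ≫ K.liftCycles (e.f i) _ rfl _ ≫
      K.homologyπ i = 𝟙 (K.homology i)
    rw [← cancel_epi (K.homologyπ i)]
    have h1 := Homotopy.homologyMap_eq (h.comp h) i
    rw [Category.comp_id, homologyMap_id] at h1
    rw [← cancel_mono (K.homologyι i)]
    have h2 := congrArg (fun t ↦ K.homologyπ i ≫ t ≫ K.homologyι i) h1
    simpa using h2)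

/-- If every differential has a generalized inverse, a complex is homotopy equivalent to its
homology. -/
theorem nonempty_homotopyEquiv_homologyComplex (K : HomologicalComplex C c)
    (h : ∀ i j, ∃ s : K.X j ⟶ K.X i, K.d i j ≫ s ≫ K.d i j = K.d i j) :
    Nonempty (HomotopyEquiv K K.homologyComplex) := by
  classical
  choose s hs using h
  let t : ∀ i j, K.X i ⟶ K.X j := fun i j ↦ if c.Rel j i then -s j i else 0
  have ht : ∀ i j, ¬ c.Rel j i → t i j = 0 := fun i j h ↦ if_neg h
  refine ⟨K.homotopyEquivHomologyComplex (𝟙 K + Homotopy.nullHomotopicMap t)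
    (((Homotopy.refl (𝟙 K)).add (Homotopy.nullHomotopy t ht)).trans (Homotopy.ofEq (by simp))) ?_⟩
  intro i j
  by_cases hij : c.Rel i j
  · have hd : dNext i t ≫ K.d i j = -K.d i j := by
      simp [dNext_eq t hij, t, hij, hs]
    simp [Homotopy.nullHomotopicMap, prevD, Preadditive.add_comp, hd, -dNext_eq_dFrom_fromNext]
  · simp [K.shape _ _ hij]

theorem quasiIso_iff_of_d_eq_zero {K L : HomologicalComplex C c} (f : K ⟶ L)
    (hK : ∀ i j, K.d i j = 0) (hL : ∀ i j, L.d i j = 0) :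
    QuasiIso f ↔ ∀ i, IsIso (f.f i) := by
  rw [quasiIso_iff]
  refine forall_congr' fun i ↦ ?_
  rw [quasiIsoAt_iff_isIso_homologyMap]
  have := K.isIso_homologyπ _ i rfl (hK _ _)
  have := L.isIso_homologyπ _ i rfl (hL _ _)
  have := K.isIso_iCycles i _ rfl (hK _ _)
  have := L.isIso_iCycles i _ rfl (hL _ _)
  rw [← isIso_comp_left_iff (K.homologyπ i), homologyπ_naturality, isIso_comp_right_iff,
    ← isIso_comp_right_iff _ (L.iCycles i), cyclesMap_i, isIso_comp_left_iff]

end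

section

variable {C I : Type*} [Category* C] [MonoidalCategory C] [Preadditive C]
  [MonoidalPreadditive C] [AddMonoid I] [DecidableEq I] {c : ComplexShape I} [c.TensorSigns]

theorem tensorHom_id (K₁ K₂ : HomologicalComplex C c) [HasTensor K₁ K₂] :
    tensorHom (𝟙 K₁) (𝟙 K₂) = 𝟙 _ := by
  ext j i₁ i₂ h
  simp

theorem tensorHom_comp {K₁ K₂ L₁ L₂ M₁ M₂ : HomologicalComplex C c} [HasTensor K₁ K₂]
    [HasTensor L₁ L₂] [HasTensor M₁ M₂] (f₁ : K₁ ⟶ L₁) (g₁ : L₁ ⟶ M₁) (f₂ : K₂ ⟶ L₂)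
    (g₂ : L₂ ⟶ M₂) :
    tensorHom (f₁ ≫ g₁) (f₂ ≫ g₂) = tensorHom f₁ f₂ ≫ tensorHom g₁ g₂ := by
  ext j i₁ i₂ h
  simp [whisker_exchange_assoc]

theorem isIso_tensorHom {K₁ K₂ L₁ L₂ : HomologicalComplex C c} [HasTensor K₁ K₂]
    [HasTensor L₁ L₂] (f₁ : K₁ ⟶ L₁) (f₂ : K₂ ⟶ L₂) [IsIso f₁] [IsIso f₂] :
    IsIso (tensorHom f₁ f₂) :=
  ⟨tensorHom (inv f₁) (inv f₂), by rw [← tensorHom_comp]; simp [tensorHom_id],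
    by rw [← tensorHom_comp]; simp [tensorHom_id]⟩

/-- The tensor product of two homotopy equivalences. -/
noncomputable def tensorHomotopyEquiv {K₁ K₂ L₁ L₂ : HomologicalComplex C c} [HasTensor K₁ K₂]
    [HasTensor L₁ L₂] (e₁ : HomotopyEquiv K₁ L₁) (e₂ : HomotopyEquiv K₂ L₂) :
    HomotopyEquiv (tensorObj K₁ K₂) (tensorObj L₁ L₂) where
  hom := tensorHom e₁.hom e₂.hom
  inv := tensorHom e₁.inv e₂.inv
  homotopyHomInvId := (Homotopy.ofEq (tensorHom_comp ..).symm).trans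
    (((mapBifunctorMapHomotopy₁ e₁.homotopyHomInvId _ _ _).trans
      (mapBifunctorMapHomotopy₂ _ e₂.homotopyHomInvId _ _)).trans (Homotopy.ofEq (tensorHom_id ..)))
  homotopyInvHomId := (Homotopy.ofEq (tensorHom_comp ..).symm).trans
    (((mapBifunctorMapHomotopy₁ e₁.homotopyInvHomId _ _ _).trans
      (mapBifunctorMapHomotopy₂ _ e₂.homotopyInvHomId _ _)).trans (Homotopy.ofEq (tensorHom_id ..)))

theorem tensorObj_d_eq_zero {K₁ K₂ : HomologicalComplex C c} [HasTensor K₁ K₂]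
    (h₁ : ∀ i j, K₁.d i j = 0) (h₂ : ∀ i j, K₂.d i j = 0) (i j : I) :
    (tensorObj K₁ K₂).d i j = 0 := by
  ext i₁ i₂ h
  rw [mapBifunctor.d_eq, Preadditive.comp_add, mapBifunctor.ι_D₁, mapBifunctor.ι_D₂]
  have e₁ : mapBifunctor.d₁ K₁ K₂ (curriedTensor C) c i₁ i₂ j = 0 := by
    by_cases h : c.Rel i₁ (c.next i₁)
    · simp [mapBifunctor.d₁_eq' _ _ _ _ h, h₁]
    · exact mapBifunctor.d₁_eq_zero _ _ _ _ _ _ _ h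
  have e₂ : mapBifunctor.d₂ K₁ K₂ (curriedTensor C) c i₁ i₂ j = 0 := by
    by_cases h : c.Rel i₂ (c.next i₂)
    · simp [mapBifunctor.d₂_eq' _ _ _ _ _ h, h₂]
    · exact mapBifunctor.d₂_eq_zero _ _ _ _ _ _ _ h
  simp [e₁, e₂]

open Classical in
/-- The projection of the tensor product onto a summand. -/
noncomputable def tensorObjProj (K₁ K₂ : HomologicalComplex C c) [HasTensor K₁ K₂] (i₁ i₂ j : I) :
    (tensorObj K₁ K₂).X j ⟶ K₁.X i₁ ⊗ K₂.X i₂ :=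
  mapBifunctorDesc fun j₁ j₂ _ ↦
    if h : j₁ = i₁ ∧ j₂ = i₂ then eqToHom (by rw [h.1, h.2]; rfl) else 0

theorem ι_tensorObjProj (K₁ K₂ : HomologicalComplex C c) [HasTensor K₁ K₂] (i₁ i₂ j : I)
    (h : i₁ + i₂ = j) : ιTensorObj K₁ K₂ i₁ i₂ j h ≫ tensorObjProj K₁ K₂ i₁ i₂ j = 𝟙 _ := by
  simp [tensorObjProj]

theorem tensorHom_proj {K₁ K₂ L₁ L₂ : HomologicalComplex C c} [HasTensor K₁ K₂]
    [HasTensor L₁ L₂] (f₁ : K₁ ⟶ L₁) (f₂ : K₂ ⟶ L₂) (i₁ i₂ j : I) :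
    (tensorHom f₁ f₂).f j ≫ tensorObjProj L₁ L₂ i₁ i₂ j =
      tensorObjProj K₁ K₂ i₁ i₂ j ≫ (f₁.f i₁ ⊗ₘ f₂.f i₂) := by
  ext j₁ j₂ h
  by_cases h' : j₁ = i₁ ∧ j₂ = i₂
  · obtain ⟨rfl, rfl⟩ := h'
    simp [tensorObjProj, MonoidalCategory.tensorHom_def]
  · simp [tensorObjProj, h']

theorem isIso_f_tensorHom_f {K₁ K₂ L₁ L₂ : HomologicalComplex C c} [HasTensor K₁ K₂]
    [HasTensor L₁ L₂] (f₁ : K₁ ⟶ L₁) (f₂ : K₂ ⟶ L₂) (i₁ i₂ : I)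
    [IsIso ((tensorHom f₁ f₂).f (i₁ + i₂))] : IsIso (f₁.f i₁ ⊗ₘ f₂.f i₂) := by
  let r : RetractArrow (f₁.f i₁ ⊗ₘ f₂.f i₂) ((tensorHom f₁ f₂).f (i₁ + i₂)) :=
    { i := Arrow.homMk (ιTensorObj K₁ K₂ i₁ i₂ _ rfl) (ιTensorObj L₁ L₂ i₁ i₂ _ rfl)
        (by simp [MonoidalCategory.tensorHom_def])
      r := Arrow.homMk (tensorObjProj K₁ K₂ i₁ i₂ _) (tensorObjProj L₁ L₂ i₁ i₂ _)
        (tensorHom_proj ..).symm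
      retract := by ext <;> simp [ι_tensorObjProj] }
  exact (MorphismProperty.isomorphisms C).of_retract r ‹_›

end

end HomologicalComplex

theorem LinearMap.injective_of_injective_map {F V V' W W' : Type*} [Field F] [AddCommGroup V]
    [Module F V] [AddCommGroup V'] [Module F V'] [AddCommGroup W] [Module F W] [AddCommGroup W']
    [Module F W'] [Nontrivial V'] (f : V →ₗ[F] W) (g : V' →ₗ[F] W')
    (h : Function.Injective (TensorProduct.map f g)) : Function.Injective f := by
  rw [← Module.FaithfullyFlat.lTensor_injective_iff_injective F V',
    LinearMap.lTensor_inj_iff_rTensor_inj]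
  rw [← LinearMap.lTensor_comp_rTensor, LinearMap.coe_comp] at h
  exact h.of_comp

theorem LinearMap.surjective_of_surjective_map {F V V' W W' : Type*} [Field F] [AddCommGroup V]
    [Module F V] [AddCommGroup V'] [Module F V'] [AddCommGroup W] [Module F W] [AddCommGroup W']
    [Module F W'] [Nontrivial W'] (f : V →ₗ[F] W) (g : V' →ₗ[F] W')
    (h : Function.Surjective (TensorProduct.map f g)) : Function.Surjective f := by
  rw [← Module.FaithfullyFlat.lTensor_surjective_iff_surjective F W',
    LinearMap.lTensor_surj_iff_rTensor_surj]
  rw [← LinearMap.rTensor_comp_lTensor, LinearMap.coe_comp] at h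
  exact h.of_comp

theorem ModuleCat.isIso_left_of_isIso_tensorHom {F : Type*} [Field F] {X Y : ModuleCat F}
    (f : X ⟶ Y) {X₁ Y₁ X₂ Y₂ : ModuleCat F} (g₁ : X₁ ⟶ Y₁) (g₂ : X₂ ⟶ Y₂) [Nontrivial X₁]
    [Nontrivial Y₂] [IsIso (f ⊗ₘ g₁)] [IsIso (f ⊗ₘ g₂)] : IsIso f := by
  rw [ConcreteCategory.isIso_iff_bijective]
  exact ⟨f.hom.injective_of_injective_map g₁.hom
      (ConcreteCategory.bijective_of_isIso (f ⊗ₘ g₁)).1,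
    f.hom.surjective_of_surjective_map g₂.hom (ConcreteCategory.bijective_of_isIso (f ⊗ₘ g₂)).2⟩

theorem ModuleCat.isIso_right_of_isIso_tensorHom {F : Type*} [Field F] {X Y : ModuleCat F}
    (f : X ⟶ Y) {X₁ Y₁ X₂ Y₂ : ModuleCat F} (g₁ : X₁ ⟶ Y₁) (g₂ : X₂ ⟶ Y₂) [Nontrivial X₁]
    [Nontrivial Y₂] [IsIso (g₁ ⊗ₘ f)] [IsIso (g₂ ⊗ₘ f)] : IsIso f := by
  have h {X' Y' : ModuleCat F} (g : X' ⟶ Y') [IsIso (g ⊗ₘ f)] : IsIso (f ⊗ₘ g) := by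
    rw [← isIso_comp_right_iff _ (β_ Y Y').hom, BraidedCategory.braiding_naturality]
    infer_instance
  have := h g₁
  have := h g₂
  exact ModuleCat.isIso_left_of_isIso_tensorHom f g₁ g₂

theorem exists_nontrivial_homology_of_not_isAcyclic {K : CochainComplex (ModuleCat k) ℤ}
    (h : ¬ IsAcyclic k K) : ∃ i, Nontrivial (K.homology i) := by
  simpa [IsAcyclic, ModuleCat.isZero_iff_subsingleton, not_subsingleton_iff_nontrivial] using h

/-- Let `k` be a field and `A'`, `B'`, `A''`, `B''` complexes of `k`-vector spaces with
chain maps `α' : A' → B'` and `α'' : A'' → B''`.  If `α'` and `α''` are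
quasi-isomorphisms, then so is `α' ⊗ α''`; conversely, if none of `A'`, `B'`, `A''`,
`B''` is acyclic and `α' ⊗ α''` is a quasi-isomorphism, then `α'` and `α''` are
quasi-isomorphisms. -/
theorem tensorHom_quasiIso_iff
    (A' B' A'' B'' : CochainComplex (ModuleCat k) ℤ)
    (α' : A' ⟶ B') (α'' : A'' ⟶ B'') :
    (QuasiIso α' → QuasiIso α'' → QuasiIso (HomologicalComplex.tensorHom α' α'')) ∧
    (¬ IsAcyclic k A' → ¬ IsAcyclic k B' → ¬ IsAcyclic k A'' → ¬ IsAcyclic k B'' →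
      QuasiIso (HomologicalComplex.tensorHom α' α'') → QuasiIso α' ∧ QuasiIso α'') := by
  obtain ⟨eA'⟩ := A'.nonempty_homotopyEquiv_homologyComplex fun _ _ ↦
    ModuleCat.exists_comp_comp_eq _
  obtain ⟨eB'⟩ := B'.nonempty_homotopyEquiv_homologyComplex fun _ _ ↦
    ModuleCat.exists_comp_comp_eq _
  obtain ⟨eA''⟩ := A''.nonempty_homotopyEquiv_homologyComplex fun _ _ ↦
    ModuleCat.exists_comp_comp_eq _
  obtain ⟨eB''⟩ := B''.nonempty_homotopyEquiv_homologyComplex fun _ _ ↦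
    ModuleCat.exists_comp_comp_eq _
  let f' := eA'.inv ≫ α' ≫ eB'.hom
  let f'' := eA''.inv ≫ α'' ≫ eB''.hom
  have h' : QuasiIso α' ↔ ∀ i, IsIso (f'.f i) := by
    rw [← HomologicalComplex.quasiIso_iff_of_d_eq_zero f' (fun _ _ ↦ rfl) (fun _ _ ↦ rfl),
      quasiIso_iff_comp_left, quasiIso_iff_comp_right]
  have h'' : QuasiIso α'' ↔ ∀ i, IsIso (f''.f i) := by
    rw [← HomologicalComplex.quasiIso_iff_of_d_eq_zero f'' (fun _ _ ↦ rfl) (fun _ _ ↦ rfl),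
      quasiIso_iff_comp_left, quasiIso_iff_comp_right]
  have h : QuasiIso (HomologicalComplex.tensorHom α' α'') ↔
      QuasiIso (HomologicalComplex.tensorHom f' f'') := by
    have h₁ : QuasiIso (HomologicalComplex.tensorHom eA'.inv eA''.inv) :=
      (HomologicalComplex.tensorHomotopyEquiv eA' eA'').quasiIso_inv
    have h₂ : QuasiIso (HomologicalComplex.tensorHom eB'.hom eB''.hom) :=
      (HomologicalComplex.tensorHomotopyEquiv eB' eB'').quasiIso_hom
    rw [HomologicalComplex.tensorHom_comp, HomologicalComplex.tensorHom_comp,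
      quasiIso_iff_comp_left, quasiIso_iff_comp_right]
  rw [h, h', h'']
  constructor
  · intro _ _
    have : IsIso f' := HomologicalComplex.Hom.isIso_of_components f'
    have : IsIso f'' := HomologicalComplex.Hom.isIso_of_components f''
    have : IsIso (HomologicalComplex.tensorHom f' f'') :=
      HomologicalComplex.isIso_tensorHom f' f''
    infer_instance
  · intro hA' hB' hA'' hB'' hf
    rw [HomologicalComplex.quasiIso_iff_of_d_eq_zero _
      (HomologicalComplex.tensorObj_d_eq_zero (fun _ _ ↦ rfl) (fun _ _ ↦ rfl))
      (HomologicalComplex.tensorObj_d_eq_zero (fun _ _ ↦ rfl) (fun _ _ ↦ rfl))] at hf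
    have hf' (p q : ℤ) : IsIso (f'.f p ⊗ₘ f''.f q) :=
      HomologicalComplex.isIso_f_tensorHom_f f' f'' p q
    obtain ⟨a', _⟩ := exists_nontrivial_homology_of_not_isAcyclic k hA'
    obtain ⟨b', _⟩ := exists_nontrivial_homology_of_not_isAcyclic k hB'
    obtain ⟨a'', _⟩ := exists_nontrivial_homology_of_not_isAcyclic k hA''
    obtain ⟨b'', _⟩ := exists_nontrivial_homology_of_not_isAcyclic k hB''
    have : Nontrivial (A'.homologyComplex.X a') := ‹Nontrivial (A'.homology a')›
    have : Nontrivial (B'.homologyComplex.X b') := ‹Nontrivial (B'.homology b')›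
    have : Nontrivial (A''.homologyComplex.X a'') := ‹Nontrivial (A''.homology a'')›
    have : Nontrivial (B''.homologyComplex.X b'') := ‹Nontrivial (B''.homology b'')›
    exact ⟨fun i ↦ ModuleCat.isIso_left_of_isIso_tensorHom (f'.f i) (f''.f a'') (f''.f b''),
      fun i ↦ ModuleCat.isIso_right_of_isIso_tensorHom (f''.f i) (f'.f a') (f'.f b')⟩
end

section
/- Let k be a field. Every chain complex L of k-vector spaces is semiprojective; concretely: for every chain map g: L → Y of complexes of k-vector spaces and every chain map p: X → Y that is both degreewise surjective and a quasi-isomorphism, there exists a chain map f: L → X with p ∘ f = g. -/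
open CategoryTheory

/-- Every morphism of vector spaces is von Neumann regular. -/
lemma ModuleCat.exists_comp_comp_eq_self {k : Type*} [Field k] {V W : ModuleCat k} (d : V ⟶ W) :
    ∃ h : W ⟶ V, d ≫ h ≫ d = d := by
  obtain ⟨s, hs⟩ := d.hom.rangeRestrict.exists_rightInverse_of_surjective d.hom.range_rangeRestrict
  obtain ⟨h, hh⟩ := s.exists_extend
  refine ⟨ModuleCat.ofHom h, ?_⟩
  ext x
  have h₁ : h (d.hom x) = s (d.hom.rangeRestrict x) :=
    LinearMap.congr_fun hh (d.hom.rangeRestrict x)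
  have h₂ := congrArg Subtype.val (LinearMap.congr_fun hs (d.hom.rangeRestrict x))
  simpa [h₁] using h₂

namespace ChainComplex

variable {C : Type*} [Category* C] [Abelian C] {X Y : ChainComplex C ℤ}

/-- A morphism from a projective object to the cycles of `Y` lifts to the cycles of `X` along an
epimorphism `X ⟶ Y` which is a quasi-isomorphism. -/
lemma exists_cycle_lift (p : X ⟶ Y) [∀ n, Epi (p.f n)] [QuasiIso p]
    {i j l : ℤ} (hij : i = j + 1) (hjl : j = l + 1) {A : C} [Projective A]
    (y : A ⟶ Y.X j) (hy : y ≫ Y.d j l = 0) :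
    ∃ x : A ⟶ X.X j, x ≫ X.d j l = 0 ∧ x ≫ p.f j = y := by
  obtain ⟨A', π, _, x, hx, w, hw⟩ :=
    (HomologicalComplex.epi_homologyMap_iff_up_to_refinements p i j l
      (by simp [hij]) (by simp [hjl])).1 inferInstance y hy
  let s := Projective.factorThru (𝟙 A) π
  have hs : s ≫ π = 𝟙 A := Projective.factorThru_comp _ _
  let v := Projective.factorThru (s ≫ w) (p.f i)
  have hv : v ≫ p.f i = s ≫ w := Projective.factorThru_comp _ _
  refine ⟨s ≫ x + v ≫ X.d i j, by simp [hx], ?_⟩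
  rw [Preadditive.add_comp, Category.assoc, Category.assoc, ← p.comm, reassoc_of% hv,
    ← Preadditive.comp_add, ← hw, reassoc_of% hs]

/-- A complex with projective terms and von Neumann regular differentials has the left lifting
property with respect to epimorphisms which are quasi-isomorphisms. -/
theorem exists_lift_of_regular {L : ChainComplex C ℤ} [∀ n, Projective (L.X n)]
    (hL : ∀ i j, ∃ h : L.X j ⟶ L.X i, L.d i j ≫ h ≫ L.d i j = L.d i j)
    (g : L ⟶ Y) (p : X ⟶ Y) [∀ n, Epi (p.f n)] [QuasiIso p] :
    ∃ f : L ⟶ X, f ≫ p = g := by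
  choose h hh using hL
  let f' (n : ℤ) : L.X n ⟶ X.X n := Projective.factorThru (g.f n) (p.f n)
  have hf' (n : ℤ) : f' n ≫ p.f n = g.f n := Projective.factorThru_comp _ _
  have key (j : ℤ) : ∃ f : L.X j ⟶ X.X j, f ≫ p.f j = g.f j ∧
      (∀ l, j = l + 1 → f ≫ X.d j l = L.d j l ≫ h j l ≫ f' j ≫ X.d j l) ∧
      (∀ i, i = j + 1 → L.d i j ≫ f = L.d i j ≫ h i j ≫ f' i ≫ X.d i j) := by
    obtain ⟨i, hi⟩ : ∃ i, i = j + 1 := ⟨_, rfl⟩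
    obtain ⟨l, hl⟩ : ∃ l, j = l + 1 := ⟨j - 1, by simp⟩
    let a := 𝟙 (L.X j) - L.d j l ≫ h j l
    let b := 𝟙 (L.X j) - h i j ≫ L.d i j
    have had : a ≫ L.d j l = 0 := by simp [a, hh]
    have hbd : b ≫ L.d j l = L.d j l := by simp [b]
    have hda : L.d i j ≫ a = L.d i j := by simp [a]
    have hdb : L.d i j ≫ b = 0 := by simp [b, hh]
    have hab : a ≫ b ≫ a ≫ b = a ≫ b := by
      have h₁ : b ≫ a = b - L.d j l ≫ h j l := by
        simp only [a, Preadditive.comp_sub, Category.comp_id, reassoc_of% hbd]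
      have h₂ : a ≫ b ≫ a = a ≫ b := by
        rw [h₁, Preadditive.comp_sub a b, reassoc_of% had, Limits.zero_comp, sub_zero]
      have h₃ : b ≫ b = b := by
        rw [Preadditive.sub_comp (𝟙 (L.X j)) (h i j ≫ L.d i j) b, Category.assoc, hdb]
        simp
      rw [reassoc_of% h₂, h₃]
    obtain ⟨x, hx, hxp⟩ := exists_cycle_lift p hi hl (a ≫ b ≫ g.f j)
      (by simp [reassoc_of% hbd, reassoc_of% had])
    refine ⟨L.d j l ≫ h j l ≫ f' j + a ≫ h i j ≫ f' i ≫ X.d i j + a ≫ b ≫ x, ?_, ?_, ?_⟩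
    · simp only [Preadditive.add_comp, Category.assoc, hf', hxp, reassoc_of% hab, ← p.comm,
        reassoc_of% hf', g.comm]
      simp [a, b]
    · intro l' hl'
      obtain rfl : l' = l := by lia
      simp [hx]
    · intro i' hi'
      obtain rfl : i' = i := by lia
      simp [reassoc_of% hda, reassoc_of% hdb]
  choose f hfp hfd hdf using key
  refine ⟨{ f := f, comm' := fun i j hij ↦ ?_ }, ?_⟩
  · have hij' : i = j + 1 := hij.symm
    rw [hfd i j hij', hdf j i hij']
  · ext n : 1
    exact hfp n

end ChainComplex

/-- Let `k` be a field.  Every chain complex `L` of `k`-vector spaces is semiprojective: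
for every chain map `g : L → Y` and every chain map `p : X → Y` which is degreewise
surjective and a quasi-isomorphism, there is a chain map `f : L → X` with `p ∘ f = g`. -/
theorem complex_semiprojective_over_field (k : Type) [Field k]
    (L X Y : ChainComplex (ModuleCat k) ℤ) (g : L ⟶ Y) (p : X ⟶ Y)
    (hsurj : ∀ n : ℤ, Function.Surjective (p.f n)) (hq : QuasiIso p) :
    ∃ f : L ⟶ X, f ≫ p = g := by
  have (n : ℤ) : Epi (p.f n) := (ModuleCat.epi_iff_surjective _).2 (hsurj n)
  exact ChainComplex.exists_lift_of_regular
    (fun _ _ ↦ ModuleCat.exists_comp_comp_eq_self _) g p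
end
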